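/- Let I ≥ 1 and let ω : [0,∞) × ℝ² → ℝ be continuously differentiable and satisfy: for every t ≥ 0, ω(t,·) ∈ L¹(ℝ²) ∩ W^{1,∞}(ℝ²) with ‖ω(t,·)‖_{L^∞} ≤ 1 and ‖ω(t,·)‖_{L¹} ≤ I; and ∂_t ω(t,x) + u(t,x)·∇_x ω(t,x) = 0 for all (t,x), where u(t,·) is the Biot–Savart velocity of ω(t,·). Then limsup_{t→∞} (ln ln max{‖∇_x ω(t,·)‖_{L^∞(ℝ²)}, e}) / t ≤ 2/π. -/

import Mathlib

open MeasureTheory Real Filter Set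
open scoped NNReal ENNReal

noncomputable section

/-- The Biot–Savart velocity of a vorticity `ω ∈ (L^∞ ∩ L¹)(ℝ²)`:
`u(x) = (1/(2π)) ∫_{ℝ²} ((x₂ − y₂, y₁ − x₁)/|x − y|²) ω(y) dy`. -/
def biotSavart (ω : ℝ × ℝ → ℝ) (x : ℝ × ℝ) : ℝ × ℝ :=
  ((1 / (2 * π)) * ∫ y : ℝ × ℝ, ((x.2 - y.2) / ((x.1 - y.1) ^ 2 + (x.2 - y.2) ^ 2)) * ω y,
   (1 / (2 * π)) * ∫ y : ℝ × ℝ, ((y.1 - x.1) / ((x.1 - y.1) ^ 2 + (x.2 - y.2) ^ 2)) * ω y)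

/-- `‖∇f‖_{L^∞(ℝ²)}` for a (Lipschitz, C¹) function `f : ℝ² → ℝ`. -/
def gradSup (f : ℝ × ℝ → ℝ) : ℝ :=
  ⨆ x : ℝ × ℝ, ‖fderiv ℝ f x‖

/-- The squared Euclidean norm on `ℝ × ℝ` (whose built-in norm is the sup norm). -/
def sqN (v : ℝ × ℝ) : ℝ := v.1 ^ 2 + v.2 ^ 2

lemma sqN_nonneg (v : ℝ × ℝ) : 0 ≤ sqN v := by unfold sqN; positivity

lemma continuous_sqN : Continuous sqN := by unfold sqN; fun_prop

lemma sqN_pos {v : ℝ × ℝ} (hv : v ≠ 0) : 0 < sqN v := by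
  refine lt_of_le_of_ne (sqN_nonneg v) fun h => hv ?_
  have h1 : v.1 ^ 2 = 0 := by unfold sqN at h; nlinarith [sq_nonneg v.1, sq_nonneg v.2]
  have h2 : v.2 ^ 2 = 0 := by unfold sqN at h; nlinarith [sq_nonneg v.1, sq_nonneg v.2]
  exact Prod.ext (by simpa using h1) (by simpa using h2)

lemma norm_sq_le_sqN (v : ℝ × ℝ) : ‖v‖ ^ 2 ≤ sqN v := by
  unfold sqN
  rcases max_choice ‖v.1‖ ‖v.2‖ with h | h <;> rw [Prod.norm_def, h, Real.norm_eq_abs, sq_abs]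
  · nlinarith [sq_nonneg v.2]
  · nlinarith [sq_nonneg v.1]

lemma sqN_le_two_norm_sq (v : ℝ × ℝ) : sqN v ≤ 2 * ‖v‖ ^ 2 := by
  unfold sqN
  have h1 : v.1 ^ 2 ≤ ‖v‖ ^ 2 := sq_le_sq.2 (by simpa using norm_fst_le v)
  have h2 : v.2 ^ 2 ≤ ‖v‖ ^ 2 := sq_le_sq.2 (by simpa using norm_snd_le v)
  linarith

lemma norm_le_sqrt_sqN (v : ℝ × ℝ) : ‖v‖ ≤ √(sqN v) :=
  Real.le_sqrt_of_sq_le (norm_sq_le_sqN v)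

/-- Polar coordinates on the annulus `p² < |v|² ≤ q²` for a function of product form. -/
lemma setIntegral_annulus_polar {h : ℝ × ℝ → ℝ} {F G : ℝ → ℝ}
    (hFG : ∀ s θ : ℝ, 0 < s → h (s * cos θ, s * sin θ) = F s * G θ)
    {p q : ℝ} (hp : 0 ≤ p) (hpq : p ≤ q) :
    ∫ v in {v : ℝ × ℝ | p ^ 2 < sqN v ∧ sqN v ≤ q ^ 2}, h v
      = (∫ s in p..q, s * F s) * ∫ θ in (-π)..π, G θ := by
  have hmeas : MeasurableSet {v : ℝ × ℝ | p ^ 2 < sqN v ∧ sqN v ≤ q ^ 2} :=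
    (measurableSet_lt measurable_const continuous_sqN.measurable).inter
      (measurableSet_le continuous_sqN.measurable measurable_const)
  rw [← integral_indicator hmeas, ← integral_comp_polarCoord_symm,
    intervalIntegral.integral_of_le hpq,
    intervalIntegral.integral_of_le (by linarith [Real.pi_pos])]
  have hsub : Ioc p q ⊆ Ioi 0 := fun s hs => lt_of_le_of_lt hp hs.1
  have e1 : ∫ s in Ioc p q, s * F s
      = ∫ s in Ioi (0 : ℝ), (Ioc p q).indicator (fun s => s * F s) s := by
    rw [setIntegral_indicator measurableSet_Ioc, inter_eq_right.2 hsub]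
  rw [e1, integral_Ioc_eq_integral_Ioo, ← setIntegral_prod_mul]
  refine setIntegral_congr_fun (measurableSet_Ioi.prod measurableSet_Ioo) ?_
  rintro ⟨s, θ⟩ ⟨hs, -⟩
  have hs : 0 < s := hs
  have hN : sqN (s * cos θ, s * sin θ) = s ^ 2 := by
    unfold sqN
    have := Real.cos_sq_add_sin_sq θ
    simp only
    linear_combination s ^ 2 * this
  simp only [polarCoord_symm_apply, smul_eq_mul]
  by_cases hmem : s ∈ Ioc p q
  · rw [indicator_of_mem hmem, indicator_of_mem, hFG s θ hs]
    · ring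
    · simp only [mem_ofPred_eq, hN]
      exact ⟨pow_lt_pow_left₀ hmem.1 hp two_ne_zero, pow_le_pow_left₀ hs.le hmem.2 2⟩
  · rw [indicator_of_notMem hmem, indicator_of_notMem]
    · simp
    · simp only [mem_ofPred_eq, hN]
      rintro ⟨h1, h2⟩
      exact hmem ⟨lt_of_pow_lt_pow_left₀ 2 hs.le h1, le_of_sq_le_sq h2 (hp.trans hpq)⟩
where
  le_of_sq_le_sq {a b : ℝ} (h : a ^ 2 ≤ b ^ 2) (hb : 0 ≤ b) : a ≤ b := abs_le_of_sq_le_sq' h hb |>.2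

lemma integral_abs_sin_mul_cos : ∫ θ in (-π)..π, |sin θ * cos θ| = 2 := by
  have key : ∀ a b : ℝ, (∀ θ ∈ uIcc a b, 0 ≤ sin θ * cos θ) →
      ∫ θ in a..b, |sin θ * cos θ| = (sin b ^ 2 - sin a ^ 2) / 2 := fun a b h => by
    rw [← integral_sin_mul_cos₁]
    exact intervalIntegral.integral_congr fun θ hθ => abs_of_nonneg (h θ hθ)
  have key' : ∀ a b : ℝ, (∀ θ ∈ uIcc a b, sin θ * cos θ ≤ 0) →
      ∫ θ in a..b, |sin θ * cos θ| = -((sin b ^ 2 - sin a ^ 2) / 2) := fun a b h => by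
    rw [← integral_sin_mul_cos₁, ← intervalIntegral.integral_neg]
    exact intervalIntegral.integral_congr fun θ hθ => abs_of_nonpos (h θ hθ)
  have hi : ∀ a b : ℝ, IntervalIntegrable (fun θ => |sin θ * cos θ|) volume a b := fun a b =>
    (by fun_prop : Continuous fun θ => |sin θ * cos θ|).intervalIntegrable a b
  have hpi := Real.pi_pos
  rw [← intervalIntegral.integral_add_adjacent_intervals (hi (-π) (-(π / 2))) (hi _ π),
    ← intervalIntegral.integral_add_adjacent_intervals (hi (-(π / 2)) 0) (hi _ π),
    ← intervalIntegral.integral_add_adjacent_intervals (hi 0 (π / 2)) (hi _ π),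
    key (-π) (-(π / 2)), key' (-(π / 2)) 0, key 0 (π / 2), key' (π / 2) π]
  · norm_num [Real.sin_neg]
  · intro θ hθ
    rw [uIcc_of_le (by linarith)] at hθ
    exact mul_nonpos_of_nonneg_of_nonpos (sin_nonneg_of_nonneg_of_le_pi (by linarith [hθ.1]) hθ.2)
      (cos_nonpos_of_pi_div_two_le_of_le hθ.1 (by linarith [hθ.2]))
  · intro θ hθ
    rw [uIcc_of_le (by linarith)] at hθ
    exact mul_nonneg (sin_nonneg_of_nonneg_of_le_pi hθ.1 (by linarith [hθ.2]))
      (cos_nonneg_of_neg_pi_div_two_le_of_le (by linarith [hθ.1]) hθ.2)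
  · intro θ hθ
    rw [uIcc_of_le (by linarith)] at hθ
    exact mul_nonpos_of_nonpos_of_nonneg (sin_nonpos_of_nonpos_of_neg_pi_le hθ.2 (by linarith [hθ.1]))
      (cos_nonneg_of_neg_pi_div_two_le_of_le (by linarith [hθ.1]) (by linarith [hθ.2]))
  · intro θ hθ
    rw [uIcc_of_le (by linarith)] at hθ
    have h1 : cos θ ≤ 0 := by
      rw [← cos_neg]
      exact cos_nonpos_of_pi_div_two_le_of_le (by linarith [hθ.2]) (by linarith [hθ.1])
    exact mul_nonneg_of_nonpos_of_nonpos
      (sin_nonpos_of_nonpos_of_neg_pi_le (by linarith [hθ.2]) hθ.1) h1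

lemma measurableSet_annulus (p q : ℝ) : MeasurableSet {v : ℝ × ℝ | p < sqN v ∧ sqN v ≤ q} :=
  (measurableSet_lt measurable_const continuous_sqN.measurable).inter
    (measurableSet_le continuous_sqN.measurable measurable_const)

lemma isBounded_annulus (p q : ℝ) :
    Bornology.IsBounded {v : ℝ × ℝ | p < sqN v ∧ sqN v ≤ q} := by
  refine (Metric.isBounded_closedBall (x := (0 : ℝ × ℝ)) (r := √q)).subset fun v hv => ?_
  rw [mem_closedBall_zero_iff]
  exact (norm_le_sqrt_sqN v).trans (Real.sqrt_le_sqrt hv.2)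

lemma volume_annulus_lt_top (p q : ℝ) :
    volume {v : ℝ × ℝ | p < sqN v ∧ sqN v ≤ q} < ⊤ := (isBounded_annulus p q).measure_lt_top

/-- A measurable function that is bounded on an annulus is integrable there. -/
lemma integrableOn_annulus {h : ℝ × ℝ → ℝ} {p q C : ℝ} (hm : Measurable h)
    (hb : ∀ v, p < sqN v → sqN v ≤ q → |h v| ≤ C) :
    IntegrableOn h {v : ℝ × ℝ | p < sqN v ∧ sqN v ≤ q} :=
  IntegrableOn.of_bound (volume_annulus_lt_top p q) hm.aestronglyMeasurable C
    ((ae_restrict_iff' (measurableSet_annulus p q)).2 (.of_forall fun v hv => hb v hv.1 hv.2))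

lemma setIntegral_abs_mul_div_sq {p q : ℝ} (hp : 0 < p) (hpq : p ≤ q) :
    ∫ v in {v : ℝ × ℝ | p ^ 2 < sqN v ∧ sqN v ≤ q ^ 2}, |v.1 * v.2| / sqN v ^ 2
      = 2 * Real.log (q / p) := by
  rw [setIntegral_annulus_polar (F := fun s => (s ^ 2)⁻¹) (G := fun θ => |sin θ * cos θ|) _ hp.le hpq,
    integral_abs_sin_mul_cos]
  · have : ∫ s in p..q, s * (s ^ 2)⁻¹ = ∫ s in p..q, s⁻¹ := by
      congr 1; ext s
      by_cases hs : s = 0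
      · simp [hs]
      · field_simp
    rw [this, integral_inv_of_pos hp (hp.trans_le hpq)]
    ring
  · intro s θ hs
    have hN : sqN (s * cos θ, s * sin θ) = s ^ 2 := by
      unfold sqN
      have := Real.cos_sq_add_sin_sq θ
      simp only
      linear_combination s ^ 2 * this
    rw [hN, show s * cos θ * (s * sin θ) = s ^ 2 * (sin θ * cos θ) by ring, abs_mul,
      abs_of_pos (by positivity : 0 < s ^ 2)]
    field_simp

lemma setIntegral_rpow {p q β : ℝ} (hp : 0 < p) (hpq : p ≤ q) (hβ : β ≠ 0) :
    ∫ v in {v : ℝ × ℝ | p ^ 2 < sqN v ∧ sqN v ≤ q ^ 2}, sqN v ^ (β - 1)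
      = π * ((q ^ (2 * β) - p ^ (2 * β)) / β) := by
  rw [setIntegral_annulus_polar (F := fun s => s ^ (2 * β - 2)) (G := fun _ => 1) _ hp.le hpq]
  · have : ∫ s in p..q, s * s ^ (2 * β - 2) = ∫ s in p..q, s ^ (2 * β - 1) := by
      refine intervalIntegral.integral_congr fun s hs => ?_
      rw [uIcc_of_le hpq] at hs
      have hs' : 0 < s := hp.trans_le hs.1
      change s * s ^ (2 * β - 2) = s ^ (2 * β - 1)
      rw [mul_comm, ← Real.rpow_add_one hs'.ne']
      congr 1; ring
    rw [this, integral_rpow]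
    · rw [sub_add_cancel, intervalIntegral.integral_const, smul_eq_mul]
      field_simp
      ring
    · right
      refine ⟨fun h => hβ (by linarith), fun h => ?_⟩
      rw [uIcc_of_le hpq] at h
      linarith [h.1]
  · intro s θ hs
    have hN : sqN (s * cos θ, s * sin θ) = s ^ 2 := by
      unfold sqN
      have := Real.cos_sq_add_sin_sq θ
      simp only
      linear_combination s ^ 2 * this
    rw [hN, mul_one, ← Real.rpow_natCast s 2, ← Real.rpow_mul hs.le]
    congr 1; push_cast; ring

lemma integrableOn_inv_norm_ball (r : ℝ) :
    IntegrableOn (fun v : ℝ × ℝ => ‖v‖⁻¹) (Metric.ball 0 r) := by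
  rw [integrableOn_fun_norm_addHaar volume (f := fun y : ℝ => y⁻¹)]
  have : Module.finrank ℝ (ℝ × ℝ) = 2 := by simp
  rw [this]
  refine (integrableOn_const (C := (1 : ℝ)) (s := Ioo 0 r) (μ := volume) (by simp)).congr_fun ?_
    measurableSet_Ioo
  intro y hy
  have := hy.1.ne'
  simp [this]

lemma integrableOn_inv_norm_sub {s : Set (ℝ × ℝ)} (hs : Bornology.IsBounded s) (c : ℝ × ℝ) :
    IntegrableOn (fun v : ℝ × ℝ => ‖v - c‖⁻¹) s := by
  obtain ⟨r, hr⟩ := hs.subset_ball c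
  refine IntegrableOn.mono_set ?_ hr
  have h := integrableOn_inv_norm_ball r
  have e : (fun v : ℝ × ℝ => v - c) ⁻¹' Metric.ball 0 r = Metric.ball c r := by
    ext v; simp [dist_eq_norm]
  rw [← e]
  exact ((measurePreserving_sub_right volume c).integrableOn_comp_preimage
    (MeasurableEquiv.subRight c).measurableEmbedding).2 h

/-- The kernel `v₁ v₂ / |v² - 1|²` (complex square) governing the normalized relative radial
velocity `⟨u(x) - u(y), x - y⟩ / |x - y|²`. -/
def strainKernel (v : ℝ × ℝ) : ℝ :=
  v.1 * v.2 / (((v.1 - 1) ^ 2 + v.2 ^ 2) * ((v.1 + 1) ^ 2 + v.2 ^ 2))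

lemma measurable_strainKernel : Measurable strainKernel := by
  unfold strainKernel; fun_prop

lemma div_sqN_le {a : ℝ} {w : ℝ × ℝ} (ha : a ^ 2 ≤ sqN w) : |a| / sqN w ≤ ‖w‖⁻¹ := by
  rcases eq_or_ne w 0 with rfl | hw
  · simp [sqN]
  · have h1 := sqN_pos hw
    have h2 : 0 < ‖w‖ := norm_pos_iff.2 hw
    rw [div_le_iff₀ h1, inv_mul_eq_div, le_div_iff₀ h2]
    have h3 : |a| ≤ √(sqN w) := Real.abs_le_sqrt ha
    calc |a| * ‖w‖ ≤ √(sqN w) * √(sqN w) :=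
          mul_le_mul h3 (norm_le_sqrt_sqN w) h2.le (Real.sqrt_nonneg _)
      _ = sqN w := Real.mul_self_sqrt h1.le

lemma abs_strainKernel_le_inv_norm (v : ℝ × ℝ) :
    |strainKernel v| ≤ ‖v - (1, 0)‖⁻¹ + ‖v - (-1, 0)‖⁻¹ := by
  have hm : (v.1 - 1) ^ 2 + v.2 ^ 2 = sqN (v - (1, 0)) := by simp [sqN]
  have hp : (v.1 + 1) ^ 2 + v.2 ^ 2 = sqN (v - (-1, 0)) := by simp [sqN]
  have h1 := div_sqN_le (a := v.2) (w := v - (1, 0)) (by simp [sqN]; positivity)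
  have h2 := div_sqN_le (a := v.2) (w := v - (-1, 0)) (by simp [sqN]; positivity)
  have e : |strainKernel v| = |v.1| * |v.2| / (sqN (v - (1, 0)) * sqN (v - (-1, 0))) := by
    rw [strainKernel, hm, hp, abs_div, abs_mul,
      abs_of_nonneg (mul_nonneg (sqN_nonneg _) (sqN_nonneg _))]
  rw [e]
  have key : ∀ w : ℝ × ℝ, |v.1| ≤ sqN w → |v.1| / sqN w ≤ 1 := fun w hw =>
    div_le_one_of_le₀ hw (sqN_nonneg w)
  rcases le_total 0 v.1 with h | h
  · have h3 := key (v - (-1, 0)) (by rw [← hp, abs_of_nonneg h]; nlinarith [sq_nonneg v.2])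
    calc _ = (|v.2| / sqN (v - (1, 0))) * (|v.1| / sqN (v - (-1, 0))) := by
          rw [div_mul_div_comm]; ring
      _ ≤ ‖v - (1, 0)‖⁻¹ * 1 := mul_le_mul h1 h3 (div_nonneg (abs_nonneg _) (sqN_nonneg _))
          (by positivity)
      _ ≤ _ := by rw [mul_one]; exact le_add_of_nonneg_right (by positivity)
  · have h3 := key (v - (1, 0)) (by rw [← hm, abs_of_nonpos h]; nlinarith [sq_nonneg v.2])
    calc _ = (|v.2| / sqN (v - (-1, 0))) * (|v.1| / sqN (v - (1, 0))) := by
          rw [div_mul_div_comm]; ring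
      _ ≤ ‖v - (-1, 0)‖⁻¹ * 1 := mul_le_mul h2 h3 (div_nonneg (abs_nonneg _) (sqN_nonneg _))
          (by positivity)
      _ ≤ _ := by rw [mul_one]; exact le_add_of_nonneg_left (by positivity)

lemma integrableOn_strainKernel {s : Set (ℝ × ℝ)} (hs : Bornology.IsBounded s) :
    IntegrableOn strainKernel s := by
  refine ((integrableOn_inv_norm_sub hs (1, 0)).add (integrableOn_inv_norm_sub hs (-1, 0))).mono'
    measurable_strainKernel.aestronglyMeasurable (.of_forall fun v => ?_)
  simpa using abs_strainKernel_le_inv_norm v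

lemma abs_mul_le_sqN (v : ℝ × ℝ) : |v.1 * v.2| ≤ sqN v / 2 := by
  unfold sqN
  rw [abs_le]
  constructor <;> nlinarith [sq_nonneg (v.1 + v.2), sq_nonneg (v.1 - v.2)]

lemma abs_strainKernel_le {v : ℝ × ℝ} (hv : 4 ≤ sqN v) :
    |strainKernel v| ≤ |v.1 * v.2| / (sqN v - 1) ^ 2 := by
  unfold strainKernel
  have h : (sqN v - 1) ^ 2 ≤ ((v.1 - 1) ^ 2 + v.2 ^ 2) * ((v.1 + 1) ^ 2 + v.2 ^ 2) := by
    unfold sqN; nlinarith [sq_nonneg v.2]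
  have h0 : 0 < (sqN v - 1) ^ 2 := by nlinarith
  rw [abs_div, abs_of_pos (h0.trans_le h)]
  exact div_le_div_of_nonneg_left (abs_nonneg _) h0 h

lemma abs_strainKernel_le_inv {v : ℝ × ℝ} (hv : 4 ≤ sqN v) :
    |strainKernel v| ≤ (sqN v)⁻¹ := by
  have h0 : 0 < (sqN v - 1) ^ 2 := by nlinarith
  refine (abs_strainKernel_le hv).trans ?_
  rw [div_le_iff₀ h0, inv_mul_eq_div, le_div_iff₀ (by linarith)]
  have := mul_le_mul_of_nonneg_right (abs_mul_le_sqN v) (by linarith : 0 ≤ sqN v)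
  nlinarith

lemma abs_strainKernel_le_add {v : ℝ × ℝ} (hv : 4 ≤ sqN v) :
    |strainKernel v| ≤ |v.1 * v.2| / sqN v ^ 2 + 2 * sqN v ^ ((-1 : ℝ) - 1) := by
  have h0 : 0 < (sqN v - 1) ^ 2 := by nlinarith
  have hN : 0 < sqN v := by linarith
  have e : sqN v ^ ((-1 : ℝ) - 1) = (sqN v ^ 2)⁻¹ := by
    rw [show ((-1 : ℝ) - 1) = -((2 : ℕ) : ℝ) by norm_num, Real.rpow_neg hN.le, Real.rpow_natCast]
  rw [e]
  refine (abs_strainKernel_le hv).trans ?_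
  have h1 : 1 / (sqN v - 1) ^ 2 ≤ 1 / sqN v ^ 2 + 4 / sqN v ^ 3 := by
    rw [div_add_div _ _ (by positivity) (by positivity), div_le_div_iff₀ h0 (by positivity)]
    nlinarith [pow_pos hN 2, pow_pos hN 3, pow_pos hN 4]
  calc |v.1 * v.2| / (sqN v - 1) ^ 2 = |v.1 * v.2| * (1 / (sqN v - 1) ^ 2) := by ring
    _ ≤ |v.1 * v.2| * (1 / sqN v ^ 2 + 4 / sqN v ^ 3) :=
        mul_le_mul_of_nonneg_left h1 (abs_nonneg _)
    _ = |v.1 * v.2| / sqN v ^ 2 + |v.1 * v.2| * (4 / sqN v ^ 3) := by ring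
    _ ≤ |v.1 * v.2| / sqN v ^ 2 + sqN v / 2 * (4 / sqN v ^ 3) := by
        gcongr; exact abs_mul_le_sqN v
    _ = _ := by field_simp; ring

lemma setIntegral_strainKernel_annulus (p q : ℝ) :
    ∫ v in {v : ℝ × ℝ | p < sqN v ∧ sqN v ≤ q}, strainKernel v = 0 := by
  have hmp : MeasurePreserving (fun v : ℝ × ℝ => (-v.1, v.2)) volume volume :=
    (Measure.measurePreserving_neg (volume : Measure ℝ)).prod (MeasurePreserving.id volume)
  let e : (ℝ × ℝ) ≃ᵐ (ℝ × ℝ) := (MeasurableEquiv.neg ℝ).prodCongr (MeasurableEquiv.refl ℝ)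
  have hme : MeasurableEmbedding (fun v : ℝ × ℝ => (-v.1, v.2)) := e.measurableEmbedding
  have h := hmp.setIntegral_preimage_emb hme strainKernel {v : ℝ × ℝ | p < sqN v ∧ sqN v ≤ q}
  have e1 : (fun v : ℝ × ℝ => (-v.1, v.2)) ⁻¹' {v : ℝ × ℝ | p < sqN v ∧ sqN v ≤ q}
      = {v : ℝ × ℝ | p < sqN v ∧ sqN v ≤ q} := by ext v; simp [sqN]
  have e2 : ∀ v : ℝ × ℝ, strainKernel (-v.1, v.2) = - strainKernel v := fun v => by
    unfold strainKernel
    simp only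
    rw [← neg_div]
    congr 1 <;> ring
  rw [e1] at h
  simp only [e2, integral_neg] at h
  linarith

/-- The constant bounding the contribution of the inner disc. -/
def strainConst : ℝ := ∫ v in {v : ℝ × ℝ | sqN v ≤ 4}, |strainKernel v|

lemma strainConst_nonneg : 0 ≤ strainConst := integral_nonneg fun _ => abs_nonneg _

lemma abs_integral_le_of_abs_le {F B : ℝ × ℝ → ℝ} (hB : Integrable B) (h : ∀ v, |F v| ≤ B v) :
    |∫ v, F v| ≤ ∫ v, B v := by
  rw [← Real.norm_eq_abs]
  exact norm_integral_le_of_norm_le hB (.of_forall h)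

lemma abs_setIntegral_le_of_abs_le {s : Set (ℝ × ℝ)} (hs : MeasurableSet s) {F B : ℝ × ℝ → ℝ}
    (hB : IntegrableOn B s) (h : ∀ v ∈ s, |F v| ≤ B v) : |∫ v in s, F v| ≤ ∫ v in s, B v := by
  rw [← Real.norm_eq_abs]
  exact norm_integral_le_of_norm_le hB ((ae_restrict_iff' hs).2 (.of_forall h))

lemma isBounded_sqN_le (q : ℝ) : Bornology.IsBounded {v : ℝ × ℝ | sqN v ≤ q} := by
  refine (Metric.isBounded_closedBall (x := (0 : ℝ × ℝ)) (r := √q)).subset fun v hv => ?_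
  rw [mem_closedBall_zero_iff]
  exact (norm_le_sqrt_sqN v).trans (Real.sqrt_le_sqrt hv)

lemma integrableOn_mul_of_abs_le_one {s : Set (ℝ × ℝ)} {F g : ℝ × ℝ → ℝ} (hF : IntegrableOn F s)
    (hg : AEStronglyMeasurable g volume) (h1 : ∀ v, |g v| ≤ 1) :
    IntegrableOn (fun v => F v * g v) s :=
  Integrable.mul_bdd hF hg.restrict (.of_forall h1)

theorem abs_integral_strainKernel_mul_le {g : ℝ × ℝ → ℝ} (hgi : Integrable g)
    (hg1 : ∀ v, |g v| ≤ 1) {ρ R β H : ℝ} (hρ : 2 ≤ ρ) (hR : ρ ≤ R) (hβ : 0 < β) (hH : 0 ≤ H)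
    (hgH : ∀ v, 4 < sqN v → sqN v ≤ ρ ^ 2 → |g v - g 0| ≤ H * sqN v ^ β) :
    |∫ v, strainKernel v * g v| ≤
      strainConst + π * H * ρ ^ (2 * β) / β + (2 * Real.log (R / ρ) + π / 2)
        + (∫ v, |g v|) / R ^ 2 := by
  have hgm := hgi.aestronglyMeasurable
  set A1 : Set (ℝ × ℝ) := {v | sqN v ≤ 4}
  set A2 : Set (ℝ × ℝ) := {v | 4 < sqN v ∧ sqN v ≤ ρ ^ 2} with hA2
  set A3 : Set (ℝ × ℝ) := {v | ρ ^ 2 < sqN v ∧ sqN v ≤ R ^ 2} with hA3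
  set A4 : Set (ℝ × ℝ) := {v | R ^ 2 < sqN v}
  have m1 : MeasurableSet A1 := measurableSet_le continuous_sqN.measurable measurable_const
  have m2 : MeasurableSet A2 := measurableSet_annulus _ _
  have m3 : MeasurableSet A3 := measurableSet_annulus _ _
  have m4 : MeasurableSet A4 := measurableSet_lt measurable_const continuous_sqN.measurable
  have hρ2 : 4 ≤ ρ ^ 2 := by nlinarith
  have hR2 : ρ ^ 2 ≤ R ^ 2 := by nlinarith
  have hRpos : 0 < R := by linarith
  have i1 : IntegrableOn (fun v => strainKernel v * g v) A1 :=
    integrableOn_mul_of_abs_le_one (integrableOn_strainKernel (isBounded_sqN_le 4)) hgm hg1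
  have i2k : IntegrableOn strainKernel A2 := integrableOn_strainKernel (isBounded_annulus _ _)
  have i2 : IntegrableOn (fun v => strainKernel v * g v) A2 :=
    integrableOn_mul_of_abs_le_one i2k hgm hg1
  have i3 : IntegrableOn (fun v => strainKernel v * g v) A3 :=
    integrableOn_mul_of_abs_le_one (integrableOn_strainKernel (isBounded_annulus _ _)) hgm hg1
  have b4 : ∀ v ∈ A4, |strainKernel v * g v| ≤ (R ^ 2)⁻¹ * |g v| := fun v hv => by
    have hv : R ^ 2 < sqN v := hv
    rw [abs_mul]
    refine mul_le_mul_of_nonneg_right ?_ (abs_nonneg _)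
    refine (abs_strainKernel_le_inv (by linarith)).trans ?_
    exact inv_anti₀ (by positivity) hv.le
  have i4' : IntegrableOn (fun v => (R ^ 2)⁻¹ * |g v|) A4 := (hgi.abs.const_mul _).integrableOn
  have i4 : IntegrableOn (fun v => strainKernel v * g v) A4 :=
    i4'.mono' (measurable_strainKernel.aestronglyMeasurable.mul hgm).restrict
      ((ae_restrict_iff' m4).2 (.of_forall b4))
  have d12 : Disjoint A1 A2 := by
    rw [Set.disjoint_left]; intro v hv hv'
    exact absurd hv'.1 (not_lt.2 hv)
  have d123 : Disjoint (A1 ∪ A2) A3 := by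
    rw [Set.disjoint_left]; rintro v (hv | hv) hv'
    · have hv : sqN v ≤ 4 := hv
      linarith [hv'.1]
    · linarith [hv'.1, hv.2]
  have d1234 : Disjoint (A1 ∪ A2 ∪ A3) A4 := by
    rw [Set.disjoint_left]; rintro v ((hv | hv) | hv) hv'
    · have hv : sqN v ≤ 4 := hv
      have hv' : R ^ 2 < sqN v := hv'
      linarith
    · have hv' : R ^ 2 < sqN v := hv'
      linarith [hv.2]
    · have hv' : R ^ 2 < sqN v := hv'
      linarith [hv.2]
  have hun : A1 ∪ A2 ∪ A3 ∪ A4 = univ := by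
    ext v
    simp only [mem_union, mem_univ, iff_true]
    rcases le_or_gt (sqN v) 4 with h | h
    · exact .inl (.inl (.inl h))
    rcases le_or_gt (sqN v) (ρ ^ 2) with h' | h'
    · exact .inl (.inl (.inr ⟨h, h'⟩))
    rcases le_or_gt (sqN v) (R ^ 2) with h'' | h''
    · exact .inl (.inr ⟨h', h''⟩)
    · exact .inr h''
  have hsplit : ∫ v, strainKernel v * g v = (∫ v in A1, strainKernel v * g v)
      + (∫ v in A2, strainKernel v * g v) + (∫ v in A3, strainKernel v * g v)
      + ∫ v in A4, strainKernel v * g v := by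
    rw [← setIntegral_univ, ← hun, setIntegral_union d1234 m4 ((i1.union i2).union i3) i4,
      setIntegral_union d123 m3 (i1.union i2) i3, setIntegral_union d12 m2 i1 i2]
  have e1 : |∫ v in A1, strainKernel v * g v| ≤ strainConst := by
    refine abs_setIntegral_le_of_abs_le m1
      (integrableOn_strainKernel (isBounded_sqN_le 4)).abs fun v _ => ?_
    rw [abs_mul]
    exact mul_le_of_le_one_right (abs_nonneg _) (hg1 v)
  have e2 : |∫ v in A2, strainKernel v * g v| ≤ π * H * ρ ^ (2 * β) / β := by
    have h0 : ∫ v in A2, strainKernel v * g v = ∫ v in A2, strainKernel v * (g v - g 0) := by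
      simp only [mul_sub]
      rw [integral_sub i2 (i2k.mul_const _), integral_mul_const,
        setIntegral_strainKernel_annulus, zero_mul, sub_zero]
    rw [h0]
    have hint : IntegrableOn (fun v => H * sqN v ^ (β - 1)) A2 := by
      refine (integrableOn_annulus (C := max (4 ^ (β - 1)) ((ρ ^ 2) ^ (β - 1)))
        (continuous_sqN.measurable.pow_const _) fun v h4 hv => ?_).const_mul H
      have hpos : 0 < sqN v := by linarith
      rw [abs_of_nonneg (Real.rpow_nonneg hpos.le _)]
      rcases le_total 0 (β - 1) with h | h
      · exact le_max_of_le_right (Real.rpow_le_rpow hpos.le hv h)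
      · exact le_max_of_le_left (Real.rpow_le_rpow_of_nonpos (by norm_num) h4.le h)
    refine (abs_setIntegral_le_of_abs_le m2 hint fun v hv => ?_).trans ?_
    · have hpos : 0 < sqN v := by linarith [hv.1]
      rw [abs_mul]
      calc |strainKernel v| * |g v - g 0| ≤ (sqN v)⁻¹ * (H * sqN v ^ β) :=
            mul_le_mul (abs_strainKernel_le_inv hv.1.le) (hgH v hv.1 hv.2) (abs_nonneg _)
              (by positivity)
        _ = H * sqN v ^ (β - 1) := by rw [Real.rpow_sub_one hpos.ne']; ring
    · rw [integral_const_mul, hA2, show (4 : ℝ) = 2 ^ 2 by norm_num,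
        setIntegral_rpow two_pos hρ hβ.ne']
      have h2 : 0 ≤ (2 : ℝ) ^ (2 * β) := by positivity
      rw [show π * H * ρ ^ (2 * β) / β = H * (π * (ρ ^ (2 * β) / β)) by ring]
      gcongr
      linarith
  have e3 : |∫ v in A3, strainKernel v * g v| ≤ 2 * Real.log (R / ρ) + π / 2 := by
    have j1 : IntegrableOn (fun v : ℝ × ℝ => |v.1 * v.2| / sqN v ^ 2) A3 := by
      refine integrableOn_annulus (C := 1) ?_ fun v h4 hv => ?_
      · exact Measurable.div (by fun_prop) (continuous_sqN.measurable.pow_const 2)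
      · have hpos : 4 < sqN v := by linarith
        rw [abs_of_nonneg (by positivity)]
        refine div_le_one_of_le₀ ((abs_mul_le_sqN v).trans ?_) (by positivity)
        nlinarith
    have j2 : IntegrableOn (fun v : ℝ × ℝ => 2 * sqN v ^ ((-1 : ℝ) - 1)) A3 := by
      refine (integrableOn_annulus (C := 1)
        (continuous_sqN.measurable.pow_const _) fun v h4 hv => ?_).const_mul 2
      have hpos : 4 < sqN v := by linarith
      rw [abs_of_nonneg (Real.rpow_nonneg (by linarith) _)]
      exact Real.rpow_le_one_of_one_le_of_nonpos (by linarith) (by norm_num)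
    refine (abs_setIntegral_le_of_abs_le m3 (j1.add j2) fun v hv => ?_).trans ?_
    · have hpos : 4 < sqN v := by linarith [hv.1]
      rw [abs_mul]
      exact (mul_le_of_le_one_right (abs_nonneg _) (hg1 v)).trans
        (abs_strainKernel_le_add hpos.le)
    · simp only [Pi.add_apply]
      rw [integral_add j1 j2, integral_const_mul, hA3,
        setIntegral_abs_mul_div_sq (by linarith) hR, setIntegral_rpow (by linarith) hR (by norm_num)]
      have h1 : R ^ (2 * (-1 : ℝ)) ≥ 0 := by positivity
      have h2 : ρ ^ (2 * (-1 : ℝ)) ≤ 1 / 4 := by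
        rw [show 2 * (-1 : ℝ) = -((2 : ℕ) : ℝ) by norm_num, Real.rpow_neg (by linarith),
          Real.rpow_natCast, inv_le_comm₀ (by positivity) (by norm_num)]
        linarith
      have h3 : (R ^ (2 * (-1 : ℝ)) - ρ ^ (2 * (-1 : ℝ))) / -1 ≤ 1 / 4 := by
        generalize R ^ (2 * (-1 : ℝ)) = a at h1 ⊢
        generalize ρ ^ (2 * (-1 : ℝ)) = b at h2 ⊢
        rw [div_neg, div_one]; linarith
      have := mul_le_mul_of_nonneg_left h3 Real.pi_pos.le
      linarith
  have e4 : |∫ v in A4, strainKernel v * g v| ≤ (∫ v, |g v|) / R ^ 2 := by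
    refine (abs_setIntegral_le_of_abs_le m4 i4' b4).trans ?_
    rw [integral_const_mul, div_eq_inv_mul]
    exact mul_le_mul_of_nonneg_left
      (setIntegral_le_integral hgi.abs (.of_forall fun v => abs_nonneg _)) (by positivity)
  rw [hsplit]
  refine (abs_add_le _ _).trans (add_le_add ((abs_add_le _ _).trans
    (add_le_add ((abs_add_le _ _).trans (add_le_add e1 e2)) e3)) e4)

/-- The majorant `‖v‖⁻¹ 1_{‖v‖ < 1}` of the singular part of the Biot–Savart kernel. -/
def nearKernel : ℝ × ℝ → ℝ := (Metric.ball 0 1).indicator fun v => ‖v‖⁻¹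

lemma integrable_nearKernel : Integrable nearKernel :=
  (integrable_indicator_iff measurableSet_ball).2 (integrableOn_inv_norm_ball 1)

lemma nearKernel_nonneg (v : ℝ × ℝ) : 0 ≤ nearKernel v :=
  indicator_nonneg (fun _ _ => by positivity) v

lemma inv_norm_mul_le {t : ℝ} (ht : |t| ≤ 1) (v : ℝ × ℝ) :
    ‖v‖⁻¹ * |t| ≤ nearKernel v + |t| := by
  by_cases hv : v ∈ Metric.ball (0 : ℝ × ℝ) 1
  · rw [nearKernel, indicator_of_mem hv]
    have : ‖v‖⁻¹ * |t| ≤ ‖v‖⁻¹ := mul_le_of_le_one_right (by positivity) ht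
    linarith [abs_nonneg t]
  · rw [nearKernel, indicator_of_notMem hv, zero_add]
    refine mul_le_of_le_one_left (abs_nonneg t) (inv_le_one_of_one_le₀ ?_)
    simpa using hv

/-- The convolution of `f` with the kernel `ℓ(v) / |v|²`. -/
def rieszInt (ℓ : ℝ × ℝ →ₗ[ℝ] ℝ) (f : ℝ × ℝ → ℝ) (x : ℝ × ℝ) : ℝ :=
  ∫ y, ℓ (x - y) / sqN (x - y) * f y

lemma biotSavart_eq (f : ℝ × ℝ → ℝ) (x : ℝ × ℝ) :
    biotSavart f x = (1 / (2 * π) * rieszInt (LinearMap.snd ℝ ℝ ℝ) f x,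
      1 / (2 * π) * rieszInt (-LinearMap.fst ℝ ℝ ℝ) f x) := by
  simp [biotSavart, rieszInt, sqN]

section Riesz

variable {ℓ : ℝ × ℝ →ₗ[ℝ] ℝ} {f : ℝ × ℝ → ℝ}

lemma measurable_linear (ℓ : ℝ × ℝ →ₗ[ℝ] ℝ) : Measurable ℓ :=
  ℓ.continuous_of_finiteDimensional.measurable

lemma measurable_rieszKernel (ℓ : ℝ × ℝ →ₗ[ℝ] ℝ) : Measurable fun v => ℓ v / sqN v :=
  (measurable_linear ℓ).div continuous_sqN.measurable

lemma abs_rieszKernel_le (hℓ : ∀ v, ℓ v ^ 2 ≤ sqN v) (v : ℝ × ℝ) :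
    |ℓ v / sqN v| ≤ ‖v‖⁻¹ := by
  rw [abs_div, abs_of_nonneg (sqN_nonneg v)]
  exact div_sqN_le (hℓ v)

lemma abs_rieszKernel_mul_le (hℓ : ∀ v, ℓ v ^ 2 ≤ sqN v) (h1 : ∀ y, |f y| ≤ 1) (x y : ℝ × ℝ) :
    |ℓ (x - y) / sqN (x - y) * f y| ≤ nearKernel (x - y) + |f y| := by
  rw [abs_mul]
  exact (mul_le_mul_of_nonneg_right (abs_rieszKernel_le hℓ _) (abs_nonneg _)).trans
    (inv_norm_mul_le (h1 y) _)

lemma integrable_rieszKernel_mul (hℓ : ∀ v, ℓ v ^ 2 ≤ sqN v) (hf : Integrable f)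
    (h1 : ∀ y, |f y| ≤ 1) (x : ℝ × ℝ) :
    Integrable fun y => ℓ (x - y) / sqN (x - y) * f y :=
  ((integrable_nearKernel.comp_sub_left x).add hf.abs).mono'
    (((measurable_rieszKernel ℓ).comp (measurable_const.sub measurable_id)).aestronglyMeasurable.mul
      hf.aestronglyMeasurable)
    (.of_forall (abs_rieszKernel_mul_le hℓ h1 x))

lemma abs_rieszInt_le (hℓ : ∀ v, ℓ v ^ 2 ≤ sqN v) (hf : Integrable f) (h1 : ∀ y, |f y| ≤ 1)
    (x : ℝ × ℝ) : |rieszInt ℓ f x| ≤ (∫ v, nearKernel v) + ∫ y, |f y| := by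
  have hn := integrable_nearKernel.comp_sub_left x
  have := abs_integral_le_of_abs_le (hn.add hf.abs) (abs_rieszKernel_mul_le hℓ h1 x)
  simp only [Pi.add_apply] at this
  rwa [integral_add hn hf.abs, integral_sub_left_eq_self] at this

lemma abs_le_sqrt_sqN (hℓ : ∀ v, ℓ v ^ 2 ≤ sqN v) (v : ℝ × ℝ) : |ℓ v| ≤ √(sqN v) :=
  Real.abs_le_sqrt (hℓ v)

lemma sqN_truncated_inversion_sub_le (v w : ℝ × ℝ) :
    sqN ((max (sqN v) 1)⁻¹ • v - (max (sqN w) 1)⁻¹ • w) ≤ sqN (v - w) := by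
  have expand : ∀ p q : ℝ, sqN (p • v - q • w)
      = p ^ 2 * sqN v - 2 * (p * q) * (v.1 * w.1 + v.2 * w.2) + q ^ 2 * sqN w := by
    intro p q; simp [sqN]; ring
  have e1 : sqN (v - w) = sqN v - 2 * (v.1 * w.1 + v.2 * w.2) + sqN w := by
    simp [sqN]; ring
  have h0 := sqN_nonneg (v - w)
  rw [expand, e1]
  rw [e1] at h0
  generalize sqN v = a at *
  generalize sqN w = b at *
  generalize v.1 * w.1 + v.2 * w.2 = c at *
  clear expand e1
  rcases le_total a 1 with ha | ha <;> rcases le_total b 1 with hb | hb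
  · rw [max_eq_right ha, max_eq_right hb]; norm_num
  · rw [max_eq_right ha, max_eq_left hb]
    have hb0 : 0 < b := by linarith
    have hb1 : 0 ≤ 1 - b⁻¹ := sub_nonneg.2 (inv_le_one_of_one_le₀ hb)
    have key : 0 ≤ (1 - b⁻¹) * (b + 1 - 2 * c) := mul_nonneg hb1 (by linarith)
    have : (1 - b⁻¹) * (b + 1 - 2 * c) = (a - 2 * c + b) -
        (1⁻¹ ^ 2 * a - 2 * (1⁻¹ * b⁻¹) * c + b⁻¹ ^ 2 * b) := by field_simp; ring
    linarith
  · rw [max_eq_left ha, max_eq_right hb]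
    have ha0 : 0 < a := by linarith
    have ha1 : 0 ≤ 1 - a⁻¹ := sub_nonneg.2 (inv_le_one_of_one_le₀ ha)
    have key : 0 ≤ (1 - a⁻¹) * (a + 1 - 2 * c) := mul_nonneg ha1 (by linarith)
    have : (1 - a⁻¹) * (a + 1 - 2 * c) = (a - 2 * c + b) -
        (a⁻¹ ^ 2 * a - 2 * (a⁻¹ * 1⁻¹) * c + 1⁻¹ ^ 2 * b) := by field_simp; ring
    linarith
  · rw [max_eq_left ha, max_eq_left hb]
    have ha0 : 0 < a := by linarith
    have hb0 : 0 < b := by linarith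
    have : a⁻¹ ^ 2 * a - 2 * (a⁻¹ * b⁻¹) * c + b⁻¹ ^ 2 * b
        = (a - 2 * c + b) * (a * b)⁻¹ := by field_simp; ring
    rw [this]
    exact mul_le_of_le_one_right h0 (inv_le_one_of_one_le₀ (by nlinarith))

lemma abs_farKernel_sub_le (hℓ : ∀ v, ℓ v ^ 2 ≤ sqN v) (v w : ℝ × ℝ) :
    |ℓ v / max (sqN v) 1 - ℓ w / max (sqN w) 1| ≤ √(sqN (v - w)) := by
  have : ℓ v / max (sqN v) 1 - ℓ w / max (sqN w) 1
      = ℓ ((max (sqN v) 1)⁻¹ • v - (max (sqN w) 1)⁻¹ • w) := by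
    rw [map_sub, map_smul, map_smul, smul_eq_mul, smul_eq_mul, div_eq_inv_mul, div_eq_inv_mul]
  rw [this]
  exact (abs_le_sqrt_sqN hℓ _).trans (Real.sqrt_le_sqrt (sqN_truncated_inversion_sub_le v w))

lemma abs_rieszKernel_sub_farKernel_le (hℓ : ∀ v, ℓ v ^ 2 ≤ sqN v) (v : ℝ × ℝ) :
    |ℓ v / sqN v - ℓ v / max (sqN v) 1| ≤ nearKernel v := by
  rcases le_or_gt 1 (sqN v) with h | h
  · rw [max_eq_left h, sub_self, abs_zero]
    exact nearKernel_nonneg v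
  · have hb : v ∈ Metric.ball (0 : ℝ × ℝ) 1 := by
      rw [mem_ball_zero_iff]
      have := norm_sq_le_sqN v
      nlinarith [norm_nonneg v]
    rw [max_eq_right h.le, nearKernel, indicator_of_mem hb]
    refine le_trans ?_ (abs_rieszKernel_le hℓ v)
    rcases (sqN_nonneg v).eq_or_lt with h0 | h0
    · have : ℓ v = 0 := by
        have := hℓ v
        rw [← h0] at this
        nlinarith [sq_nonneg (ℓ v)]
      simp [this]
    · rw [div_one, abs_div, abs_of_pos h0,
        show ℓ v / sqN v - ℓ v = ℓ v * ((sqN v)⁻¹ - 1) by ring, abs_mul,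
        abs_of_nonneg (sub_nonneg.2 (one_le_inv₀ h0 |>.2 h.le)), div_eq_mul_inv]
      exact mul_le_mul_of_nonneg_left (by linarith) (abs_nonneg _)

lemma sqrt_sqN_le (v : ℝ × ℝ) : √(sqN v) ≤ 2 * ‖v‖ := by
  refine Real.sqrt_le_iff.2 ⟨by positivity, ?_⟩
  nlinarith [sqN_le_two_norm_sq v, sq_nonneg ‖v‖]

/-- Local Lipschitz bound: the near part of the kernel sees only `f` on a slightly larger ball. -/
lemma abs_rieszInt_sub_le (hℓ : ∀ v, ℓ v ^ 2 ≤ sqN v) (hf : Integrable f) (h1 : ∀ y, |f y| ≤ 1)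
    {L : ℝ} {x x' : ℝ × ℝ} (hL : ∀ v : ℝ × ℝ, ‖v‖ < 1 → |f (x - v) - f (x' - v)| ≤ L * ‖x - x'‖) :
    |rieszInt ℓ f x - rieszInt ℓ f x'|
      ≤ ((∫ v, nearKernel v) * L + 2 * ∫ y, |f y|) * ‖x - x'‖ := by
  set Kf : ℝ × ℝ → ℝ := fun v => ℓ v / max (sqN v) 1
  set Kn : ℝ × ℝ → ℝ := fun v => ℓ v / sqN v - ℓ v / max (sqN v) 1
  have mKf : Measurable Kf :=
    (measurable_linear ℓ).div (continuous_sqN.measurable.max measurable_const)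
  have mKn : Measurable Kn := (measurable_rieszKernel ℓ).sub mKf
  have hKn : ∀ v, |Kn v| ≤ nearKernel v := abs_rieszKernel_sub_farKernel_le hℓ
  have iKn : Integrable Kn :=
    integrable_nearKernel.mono' mKn.aestronglyMeasurable (.of_forall hKn)
  have in' : ∀ z, Integrable fun v => Kn v * f (z - v) := fun z =>
    iKn.mul_bdd (hf.comp_sub_left z).aestronglyMeasurable (.of_forall fun v => h1 _)
  have in'' : ∀ z, Integrable fun y => Kn (z - y) * f y := fun z =>
    (iKn.comp_sub_left z).mul_bdd hf.aestronglyMeasurable (.of_forall h1)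
  have iF : ∀ z, Integrable fun y => Kf (z - y) * f y := fun z => by
    refine ((integrable_rieszKernel_mul hℓ hf h1 z).sub (in'' z)).congr (.of_forall fun y => ?_)
    simp only [Kf, Kn, Pi.sub_apply]; ring
  have split : ∀ z, rieszInt ℓ f z = (∫ v, Kn v * f (z - v)) + ∫ y, Kf (z - y) * f y := fun z => by
    rw [← integral_sub_left_eq_self (fun v => Kn v * f (z - v)) volume z]
    simp only [sub_sub_cancel]
    rw [← integral_add (in'' z) (iF z), rieszInt]
    congr 1; ext y; simp only [Kf, Kn]; ring
  have near : |(∫ v, Kn v * f (x - v)) - ∫ v, Kn v * f (x' - v)|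
      ≤ (∫ v, nearKernel v) * L * ‖x - x'‖ := by
    rw [← integral_sub (in' x) (in' x'), mul_assoc, ← integral_mul_const]
    refine abs_integral_le_of_abs_le (integrable_nearKernel.mul_const _) fun v => ?_
    rw [← mul_sub, abs_mul]
    by_cases hv : ‖v‖ < 1
    · exact mul_le_mul (hKn v) (hL v hv) (abs_nonneg _) (nearKernel_nonneg v)
    · have h0 : nearKernel v = 0 := indicator_of_notMem (by simpa using hv) _
      have h0' : |Kn v| ≤ 0 := h0 ▸ hKn v
      rw [h0, zero_mul, le_antisymm h0' (abs_nonneg _), zero_mul]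
  have far : |(∫ y, Kf (x - y) * f y) - ∫ y, Kf (x' - y) * f y|
      ≤ (2 * ∫ y, |f y|) * ‖x - x'‖ := by
    rw [← integral_sub (iF x) (iF x'),
      show (2 * ∫ y, |f y|) * ‖x - x'‖ = 2 * ‖x - x'‖ * ∫ y, |f y| by ring, ← integral_const_mul]
    refine abs_integral_le_of_abs_le (hf.abs.const_mul _) fun y => ?_
    rw [← sub_mul, abs_mul]
    refine mul_le_mul_of_nonneg_right ?_ (abs_nonneg _)
    refine (abs_farKernel_sub_le hℓ (x - y) (x' - y)).trans ?_
    rw [sub_sub_sub_cancel_right]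
    exact sqrt_sqN_le _
  rw [split, split, add_sub_add_comm, add_mul]
  exact (abs_add_le _ _).trans (add_le_add near far)

/-- Continuity in a parameter, from pointwise continuity and a uniform `L¹ ∩ L^∞` bound. -/
lemma continuousOn_rieszInt (hℓ : ∀ v, ℓ v ^ 2 ≤ sqN v) {ω : ℝ → ℝ × ℝ → ℝ} {s : Set ℝ} {I : ℝ}
    (hc : ∀ y, ContinuousOn (fun t => ω t y) s) (hi : ∀ t ∈ s, Integrable (ω t))
    (h1 : ∀ t ∈ s, ∀ y, |ω t y| ≤ 1) (hI : ∀ t ∈ s, ∫ y, |ω t y| ≤ I) (x : ℝ × ℝ) :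
    ContinuousOn (fun t => rieszInt ℓ (ω t) x) s := by
  set F : ℕ → ℝ → ℝ := fun n t =>
    ∫ y in Metric.ball x (n + 1), ℓ (x - y) / sqN (x - y) * ω t y with hF
  have hFc : ∀ n, ContinuousOn (F n) s := fun n => by
    refine continuousOn_of_dominated (bound := fun y => ‖y - x‖⁻¹) (fun t ht =>
      (integrable_rieszKernel_mul hℓ (hi t ht) (h1 t ht) x).aestronglyMeasurable.restrict)
      (fun t ht => .of_forall fun y => ?_)
      (integrableOn_inv_norm_sub Metric.isBounded_ball x)
      (.of_forall fun y => continuousOn_const.mul (hc y))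
    rw [norm_mul, ← norm_sub_rev x y]
    exact (mul_le_of_le_one_right (norm_nonneg _) (h1 t ht y)).trans (abs_rieszKernel_le hℓ _)
  have hlim : TendstoUniformlyOn F (fun t => rieszInt ℓ (ω t) x) atTop s := by
    rw [Metric.tendstoUniformlyOn_iff]
    intro ε hε
    obtain ⟨N, hN⟩ := exists_nat_gt (I / ε)
    filter_upwards [eventually_ge_atTop N] with n hn t ht
    have hn' : (N : ℝ) ≤ n := by exact_mod_cast hn
    have hint := integrable_rieszKernel_mul hℓ (hi t ht) (h1 t ht) x
    have hpos : (0 : ℝ) < n + 1 := by positivity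
    rw [Real.dist_eq, rieszInt, ← integral_add_compl (measurableSet_ball (x := x) (ε := (n : ℝ) + 1))
      hint, hF, add_sub_cancel_left]
    have hb : |∫ y in (Metric.ball x ((n : ℝ) + 1))ᶜ, ℓ (x - y) / sqN (x - y) * ω t y|
        ≤ ∫ y in (Metric.ball x ((n : ℝ) + 1))ᶜ, ((n : ℝ) + 1)⁻¹ * |ω t y| := by
      refine abs_setIntegral_le_of_abs_le measurableSet_ball.compl
        ((hi t ht).abs.const_mul _).integrableOn fun y hy => ?_
      rw [abs_mul]
      refine mul_le_mul_of_nonneg_right ((abs_rieszKernel_le hℓ _).trans ?_) (abs_nonneg _)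
      refine inv_anti₀ hpos ?_
      rw [← dist_eq_norm, dist_comm]
      simpa using hy
    refine hb.trans_lt ?_
    have h2 : ∫ y in (Metric.ball x ((n : ℝ) + 1))ᶜ, |ω t y| ≤ I :=
      (setIntegral_le_integral (hi t ht).abs (.of_forall fun v => abs_nonneg _)).trans (hI t ht)
    rw [integral_const_mul, inv_mul_eq_div, div_lt_iff₀ hpos]
    rw [div_lt_iff₀ hε] at hN
    nlinarith
  exact hlim.continuousOn (.of_forall hFc)

end Riesz

lemma snd_sq_le_sqN (v : ℝ × ℝ) : LinearMap.snd ℝ ℝ ℝ v ^ 2 ≤ sqN v := by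
  simp [sqN]; positivity

lemma neg_fst_sq_le_sqN (v : ℝ × ℝ) : (-LinearMap.fst ℝ ℝ ℝ) v ^ 2 ≤ sqN v := by
  simp [sqN]; positivity

/-- Complex multiplication by `a`, as a linear map on `ℝ × ℝ`. -/
def complexMul (a : ℝ × ℝ) : ℝ × ℝ →L[ℝ] ℝ × ℝ :=
  LinearMap.toContinuousLinearMap
    (Matrix.toLin (Module.Basis.finTwoProd ℝ) (Module.Basis.finTwoProd ℝ) !![a.1, -a.2; a.2, a.1])

lemma complexMul_apply (a v : ℝ × ℝ) :
    complexMul a v = (a.1 * v.1 - a.2 * v.2, a.2 * v.1 + a.1 * v.2) := by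
  simp [complexMul, Matrix.toLin_finTwoProd_apply, sub_eq_add_neg]

lemma det_complexMul (a : ℝ × ℝ) : (complexMul a).det = sqN a := by
  rw [complexMul, LinearMap.det_toContinuousLinearMap, LinearMap.det_toLin, Matrix.det_fin_two_of,
    sqN]
  ring

lemma sqN_complexMul (a v : ℝ × ℝ) : sqN (complexMul a v) = sqN a * sqN v := by
  rw [complexMul_apply]; simp only [sqN]; ring

section Similarity

variable {a : ℝ × ℝ} (ha : a ≠ 0) (z : ℝ × ℝ)
include ha

lemma injective_similarity : Function.Injective fun v => z + complexMul a v := by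
  intro v w h
  have h' : complexMul a (v - w) = 0 := by
    rw [map_sub, sub_eq_zero]; exact add_left_cancel h
  have h2 := sqN_complexMul a (v - w)
  rw [h'] at h2
  by_contra hne
  have := mul_pos (sqN_pos ha) (sqN_pos (sub_ne_zero.2 hne))
  rw [← h2] at this
  simp [sqN] at this

lemma range_similarity : range (fun v => z + complexMul a v) = univ := by
  rw [range_eq_univ]
  intro w
  have hN := (sqN_pos ha).ne'
  refine ⟨((a.1 * (w - z).1 + a.2 * (w - z).2) / sqN a,
    (a.1 * (w - z).2 - a.2 * (w - z).1) / sqN a), ?_⟩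
  simp only [complexMul_apply]
  have e : a.1 ^ 2 + a.2 ^ 2 ≠ 0 := hN
  ext <;> simp only [Prod.fst_add, Prod.snd_add, Prod.fst_sub, Prod.snd_sub, sqN] <;>
    field_simp <;> ring

lemma integral_similarity (F : ℝ × ℝ → ℝ) :
    ∫ w, F w = sqN a * ∫ v, F (z + complexMul a v) := by
  have h := integral_image_eq_integral_abs_det_fderiv_smul volume MeasurableSet.univ
    (f := fun v => z + complexMul a v) (f' := fun _ => complexMul a)
    (fun v _ => ((complexMul a).hasFDerivAt.const_add z).hasFDerivWithinAt)
    (injective_similarity ha z).injOn F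
  rw [image_univ, range_similarity ha z, setIntegral_univ, setIntegral_univ] at h
  rw [h]
  simp only [det_complexMul, abs_of_nonneg (sqN_nonneg a), smul_eq_mul]
  rw [integral_const_mul]

lemma integrable_similarity {F : ℝ × ℝ → ℝ} (hF : Integrable F) :
    Integrable fun v => F (z + complexMul a v) := by
  have h := integrableOn_image_iff_integrableOn_abs_det_fderiv_smul volume MeasurableSet.univ
    (f := fun v => z + complexMul a v) (f' := fun _ => complexMul a)
    (fun v _ => ((complexMul a).hasFDerivAt.const_add z).hasFDerivWithinAt)
    (injective_similarity ha z).injOn F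
  rw [image_univ, range_similarity ha z, integrableOn_univ, integrableOn_univ] at h
  have h2 := (h.1 hF).const_mul (sqN a)⁻¹
  refine h2.congr (.of_forall fun v => ?_)
  simp only [det_complexMul, abs_of_nonneg (sqN_nonneg a), smul_eq_mul]
  rw [inv_mul_cancel_left₀ (sqN_pos ha).ne']

end Similarity

/-- The unnormalized relative radial velocity `⟨u(x) - u(y), x - y⟩`. -/
def radialVel (f : ℝ × ℝ → ℝ) (x y : ℝ × ℝ) : ℝ :=
  (x.1 - y.1) * ((biotSavart f x).1 - (biotSavart f y).1)
    + (x.2 - y.2) * ((biotSavart f x).2 - (biotSavart f y).2)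

lemma radialVel_integrand_eq {a : ℝ × ℝ} (ha : a ≠ 0) (v : ℝ × ℝ) :
    2 * a.1 * ((a - complexMul a v).2 / sqN (a - complexMul a v)
        - (-a - complexMul a v).2 / sqN (-a - complexMul a v))
      + 2 * a.2 * (-(a - complexMul a v).1 / sqN (a - complexMul a v)
        - (-(-a - complexMul a v).1) / sqN (-a - complexMul a v))
      = -8 * strainKernel v := by
  have hN : sqN a ≠ 0 := (sqN_pos ha).ne'
  have e1 : sqN (a - complexMul a v) = sqN a * ((v.1 - 1) ^ 2 + v.2 ^ 2) := by
    rw [complexMul_apply]; simp [sqN]; ring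
  have e2 : sqN (-a - complexMul a v) = sqN a * ((v.1 + 1) ^ 2 + v.2 ^ 2) := by
    rw [complexMul_apply]; simp [sqN]; ring
  rw [e1, e2]
  have e3 : 2 * a.1 * (a - complexMul a v).2 + 2 * a.2 * (-(a - complexMul a v).1)
      = -2 * sqN a * v.2 := by
    rw [complexMul_apply]; simp [sqN]; ring
  have e4 : 2 * a.1 * (-a - complexMul a v).2 + 2 * a.2 * (-(-a - complexMul a v).1)
      = -2 * sqN a * v.2 := by
    rw [complexMul_apply]; simp [sqN]; ring
  have e5 : 2 * a.1 * ((a - complexMul a v).2 / (sqN a * ((v.1 - 1) ^ 2 + v.2 ^ 2))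
        - (-a - complexMul a v).2 / (sqN a * ((v.1 + 1) ^ 2 + v.2 ^ 2)))
      + 2 * a.2 * (-(a - complexMul a v).1 / (sqN a * ((v.1 - 1) ^ 2 + v.2 ^ 2))
        - (-(-a - complexMul a v).1) / (sqN a * ((v.1 + 1) ^ 2 + v.2 ^ 2)))
      = (-2 * sqN a * v.2) / (sqN a * ((v.1 - 1) ^ 2 + v.2 ^ 2))
        - (-2 * sqN a * v.2) / (sqN a * ((v.1 + 1) ^ 2 + v.2 ^ 2)) := by
    linear_combination e3 / (sqN a * ((v.1 - 1) ^ 2 + v.2 ^ 2))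
      - e4 / (sqN a * ((v.1 + 1) ^ 2 + v.2 ^ 2))
  rw [e5, strainKernel]
  rcases eq_or_ne v.2 0 with h | h
  · simp [h]
  · have h1 : (v.1 - 1) ^ 2 + v.2 ^ 2 ≠ 0 := by positivity
    have h2 : (v.1 + 1) ^ 2 + v.2 ^ 2 ≠ 0 := by positivity
    field_simp
    ring

lemma radialVel_eq {f : ℝ × ℝ → ℝ} (hf : Integrable f) (h1 : ∀ y, |f y| ≤ 1) (z : ℝ × ℝ)
    {a : ℝ × ℝ} (ha : a ≠ 0) :
    radialVel f (z + a) (z - a)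
      = -(4 * sqN a / π) * ∫ v, strainKernel v * f (z + complexMul a v) := by
  have i1 := fun x => integrable_rieszKernel_mul snd_sq_le_sqN hf h1 x
  have i2 := fun x => integrable_rieszKernel_mul neg_fst_sq_le_sqN hf h1 x
  have hpi := Real.pi_ne_zero
  have key : 2 * a.1 * (rieszInt (LinearMap.snd ℝ ℝ ℝ) f (z + a)
        - rieszInt (LinearMap.snd ℝ ℝ ℝ) f (z - a))
      + 2 * a.2 * (rieszInt (-LinearMap.fst ℝ ℝ ℝ) f (z + a)
        - rieszInt (-LinearMap.fst ℝ ℝ ℝ) f (z - a))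
      = sqN a * (-8 * ∫ v, strainKernel v * f (z + complexMul a v)) := by
    unfold rieszInt
    rw [← integral_sub (i1 _) (i1 _), ← integral_sub (i2 _) (i2 _), ← integral_const_mul,
      ← integral_const_mul, ← integral_add (by exact ((i1 _).sub (i1 _)).const_mul _)
        (by exact ((i2 _).sub (i2 _)).const_mul _), integral_similarity ha z,
      ← integral_const_mul (-8 : ℝ)]
    congr 1
    refine integral_congr_ae (.of_forall fun v => ?_)
    dsimp only
    rw [← mul_assoc, ← radialVel_integrand_eq ha v, add_sub_add_left_eq_sub,
      show z - a - (z + complexMul a v) = -a - complexMul a v by abel]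
    simp only [LinearMap.snd_apply, LinearMap.neg_apply, LinearMap.fst_apply]
    ring
  rw [radialVel, biotSavart_eq, biotSavart_eq]
  simp only [Prod.fst_add, Prod.fst_sub, Prod.snd_add, Prod.snd_sub]
  have : -(4 * sqN a / π) * ∫ v, strainKernel v * f (z + complexMul a v)
      = 1 / (2 * π) * (sqN a * (-8 * ∫ v, strainKernel v * f (z + complexMul a v))) := by
    field_simp; ring
  rw [this, ← key]
  ring

/-- The central estimate: a bound on the relative radial velocity with the sharp constant in front
of the logarithm, given a Hölder bound below the scale `√d`. -/
theorem abs_radialVel_le {f : ℝ × ℝ → ℝ} (hf : Integrable f) (h1 : ∀ y, |f y| ≤ 1) {I : ℝ}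
    (hI : ∫ y, |f y| ≤ I) {x y : ℝ × ℝ} (hxy : x ≠ y) {d β H : ℝ} (hd : sqN (x - y) ≤ d)
    (hd1 : d ≤ 1) (hβ : 0 < β) (hH : 0 ≤ H)
    (hfH : ∀ w w', sqN (x - y) < sqN (w - w') → sqN (w - w') ≤ d →
      |f w - f w'| ≤ H * sqN (w - w') ^ β) :
    |radialVel f x y| ≤ sqN (x - y) / π *
      (strainConst + π * H * d ^ β / β - Real.log d + π / 2 + I) := by
  set a : ℝ × ℝ := (2⁻¹ : ℝ) • (x - y) with haD
  set z : ℝ × ℝ := (2⁻¹ : ℝ) • (x + y) with hzD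
  have hx : x = z + a := by ext <;> simp [a, z] <;> ring
  have hy : y = z - a := by ext <;> simp [a, z] <;> ring
  have ha : a ≠ 0 := smul_ne_zero (by norm_num) (sub_ne_zero.2 hxy)
  have hn : sqN (x - y) = 4 * sqN a := by simp [a, sqN]; ring
  have hNa := sqN_pos ha
  have hd0 : 0 < d := by linarith
  rw [hn] at hd hfH
  set g : ℝ × ℝ → ℝ := fun v => f (z + complexMul a v) with hg
  have hgi : Integrable g := integrable_similarity ha z hf
  have hgI : ∫ v, |g v| = (∫ w, |f w|) / sqN a := by
    rw [integral_similarity ha z fun w => |f w|, mul_div_cancel_left₀ _ hNa.ne']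
  have hs : 0 < √(sqN a) := Real.sqrt_pos.2 hNa
  have hR2 : (1 / √(sqN a)) ^ 2 = 1 / sqN a := by rw [div_pow, Real.sq_sqrt hNa.le, one_pow]
  have hρ2 : (√d / √(sqN a)) ^ 2 = d / sqN a := by
    rw [div_pow, Real.sq_sqrt hNa.le, Real.sq_sqrt hd0.le]
  have hρ0 : 0 ≤ √d / √(sqN a) := by positivity
  have hρβ : (√d / √(sqN a)) ^ (2 * β) = d ^ β / sqN a ^ β := by
    rw [Real.rpow_mul hρ0, show (2 : ℝ) = ((2 : ℕ) : ℝ) by norm_num, Real.rpow_natCast, hρ2,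
      Real.div_rpow hd0.le hNa.le]
  have h2 : 2 ≤ √d / √(sqN a) := by
    refine abs_le_of_sq_le_sq' ?_ hρ0 |>.2
    rw [hρ2, le_div_iff₀ hNa]; linarith
  have key := abs_integral_strainKernel_mul_le (g := g) hgi (fun v => h1 _) (ρ := √d / √(sqN a))
    (R := 1 / √(sqN a)) (β := β) (H := H * sqN a ^ β) h2
    (by gcongr; exact Real.sqrt_le_one.2 hd1) hβ (by positivity) (fun v h4 hv => by
      rw [hρ2, le_div_iff₀ hNa] at hv
      have := hfH (z + complexMul a v) z
      rw [add_sub_cancel_left, sqN_complexMul, Real.mul_rpow hNa.le (sqN_nonneg v)] at this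
      simp only [hg, map_zero, add_zero]
      rw [mul_assoc]
      exact this (by nlinarith) (by linarith))
  have hlog : Real.log (1 / √(sqN a) / (√d / √(sqN a))) = -(Real.log d / 2) := by
    rw [div_div_div_cancel_right₀ hs.ne', one_div, Real.log_inv, Real.log_sqrt hd0.le]
  rw [hR2, hgI, hρβ, hlog, div_div_div_cancel_right₀ hNa.ne', div_one] at key
  have hHd : π * (H * sqN a ^ β) * (d ^ β / sqN a ^ β) / β = π * H * d ^ β / β := by
    have : sqN a ^ β ≠ 0 := (Real.rpow_pos_of_pos hNa β).ne'
    field_simp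
  rw [hHd] at key
  rw [hn, hx, hy, radialVel_eq hf h1 z ha, abs_mul, abs_neg, abs_of_pos (by positivity)]
  refine mul_le_mul_of_nonneg_left (key.trans ?_) (by positivity)
  linarith

lemma abs_biotSavart_le {f : ℝ × ℝ → ℝ} (hf : Integrable f) (h1 : ∀ y, |f y| ≤ 1) {I : ℝ}
    (hI : ∫ y, |f y| ≤ I) (x : ℝ × ℝ) :
    |(biotSavart f x).1| ≤ (∫ v, nearKernel v) + I ∧
      |(biotSavart f x).2| ≤ (∫ v, nearKernel v) + I := by
  have hle : ∀ r : ℝ, |r| ≤ (∫ v, nearKernel v) + ∫ y, |f y| →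
      |1 / (2 * π) * r| ≤ (∫ v, nearKernel v) + I := fun r hr => by
    rw [abs_mul, abs_of_pos (by positivity : 0 < 1 / (2 * π))]
    refine (mul_le_of_le_one_left (abs_nonneg r) ?_).trans (hr.trans (by linarith))
    rw [div_le_one (by positivity)]
    linarith [Real.pi_gt_three]
  rw [biotSavart_eq]
  exact ⟨hle _ (abs_rieszInt_le snd_sq_le_sqN hf h1 x),
    hle _ (abs_rieszInt_le neg_fst_sq_le_sqN hf h1 x)⟩

lemma integral_nearKernel_nonneg : 0 ≤ ∫ v, nearKernel v := integral_nonneg nearKernel_nonneg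

/-- Crude bound on the relative radial velocity, used at distances at least one. -/
lemma abs_radialVel_le_of_one_le {f : ℝ × ℝ → ℝ} (hf : Integrable f) (h1 : ∀ y, |f y| ≤ 1) {I : ℝ}
    (hI : ∫ y, |f y| ≤ I) {x y : ℝ × ℝ} (hxy : 1 ≤ sqN (x - y)) :
    |radialVel f x y| ≤ sqN (x - y) * (4 * ((∫ v, nearKernel v) + I)) := by
  set M := (∫ v, nearKernel v) + I
  have hx := abs_biotSavart_le hf h1 hI x
  have hy := abs_biotSavart_le hf h1 hI y
  have hM : 0 ≤ M := (abs_nonneg _).trans hx.1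
  have hr : √(sqN (x - y)) ≤ sqN (x - y) :=
    Real.sqrt_le_iff.2 ⟨by linarith, by nlinarith⟩
  have c1 : |x.1 - y.1| ≤ sqN (x - y) :=
    (Real.abs_le_sqrt (by simp [sqN]; positivity)).trans hr
  have c2 : |x.2 - y.2| ≤ sqN (x - y) :=
    (Real.abs_le_sqrt (by simp [sqN]; positivity)).trans hr
  have d1 : |(biotSavart f x).1 - (biotSavart f y).1| ≤ 2 * M :=
    (abs_sub _ _).trans (by linarith [hx.1, hy.1])
  have d2 : |(biotSavart f x).2 - (biotSavart f y).2| ≤ 2 * M :=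
    (abs_sub _ _).trans (by linarith [hx.2, hy.2])
  refine (abs_add_le _ _).trans ?_
  rw [abs_mul, abs_mul]
  have m1 := mul_le_mul c1 d1 (abs_nonneg _) (by linarith)
  have m2 := mul_le_mul c2 d2 (abs_nonneg _) (by linarith)
  linarith

/-- The additive constant in the radial velocity bounds for vorticities of `L¹` norm at most `I`. -/
def radialConst (I : ℝ) : ℝ := 4 * ((∫ v, nearKernel v) + I) + strainConst + 1

lemma radialConst_pos {I : ℝ} (hI : 0 ≤ I) : 0 < radialConst I := by
  unfold radialConst
  linarith [integral_nearKernel_nonneg, strainConst_nonneg]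

lemma div_pi_le_radialConst {I : ℝ} (hI : 0 ≤ I) :
    (strainConst + π / 2 + I) / π ≤ radialConst I := by
  have h3 := Real.pi_gt_three
  rw [div_le_iff₀ Real.pi_pos, radialConst]
  have := integral_nearKernel_nonneg
  have := strainConst_nonneg
  nlinarith

/-- Log-Lipschitz bound with the sharp constant. -/
theorem abs_radialVel_le_log {f : ℝ × ℝ → ℝ} (hf : Integrable f) (h1 : ∀ y, |f y| ≤ 1) {I : ℝ}
    (hI : ∫ y, |f y| ≤ I) {x y : ℝ × ℝ} (hxy : x ≠ y) :
    |radialVel f x y| ≤ sqN (x - y) *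
      (radialConst I + 1 / π * Real.log (1 + 1 / sqN (x - y))) := by
  have hI0 : 0 ≤ I := (integral_nonneg fun _ => abs_nonneg _).trans hI
  have hn := sqN_pos (sub_ne_zero.2 hxy)
  have hlog : 0 ≤ Real.log (1 + 1 / sqN (x - y)) :=
    Real.log_nonneg (le_add_of_nonneg_right (by positivity))
  rcases le_total (sqN (x - y)) 1 with h | h
  · have key := abs_radialVel_le hf h1 hI hxy le_rfl h one_pos le_rfl
      (fun w w' h h' => absurd h (not_lt.2 h'))
    refine key.trans ?_
    rw [div_mul_eq_mul_div, mul_div_assoc]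
    refine mul_le_mul_of_nonneg_left ?_ hn.le
    have hl : -Real.log (sqN (x - y)) ≤ Real.log (1 + 1 / sqN (x - y)) := by
      rw [← Real.log_inv]
      exact Real.log_le_log (by positivity) (by rw [one_div]; linarith)
    have := div_pi_le_radialConst hI0
    rw [show (strainConst + π * 0 * sqN (x - y) ^ (1 : ℝ) / 1 - Real.log (sqN (x - y))
        + π / 2 + I) / π
      = (strainConst + π / 2 + I) / π + 1 / π * (-Real.log (sqN (x - y))) by ring]
    gcongr
  · refine (abs_radialVel_le_of_one_le hf h1 hI h).trans ?_
    refine mul_le_mul_of_nonneg_left ?_ hn.le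
    have : 0 ≤ 1 / π * Real.log (1 + 1 / sqN (x - y)) := by positivity
    unfold radialConst
    linarith [strainConst_nonneg]

/-- For a Hölder vorticity the relative radial velocity is Lipschitz. -/
theorem abs_radialVel_le_of_holder {f : ℝ × ℝ → ℝ} (hf : Integrable f) (h1 : ∀ y, |f y| ≤ 1)
    {I : ℝ} (hI : ∫ y, |f y| ≤ I) {x y : ℝ × ℝ} (hxy : x ≠ y) {β H : ℝ} (hβ : 0 < β) (hβ1 : β ≤ 1)
    (hH : 1 ≤ H) (hfH : ∀ w w', |f w - f w'| ≤ H * sqN (w - w') ^ β) :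
    |radialVel f x y| ≤ sqN (x - y) * ((radialConst I + 1 + Real.log H) / β) := by
  have hI0 : 0 ≤ I := (integral_nonneg fun _ => abs_nonneg _).trans hI
  have hn := sqN_pos (sub_ne_zero.2 hxy)
  have hlogH : 0 ≤ Real.log H := Real.log_nonneg hH
  have hH0 : 0 < H := by linarith
  have hC := radialConst_pos hI0
  have hpi := Real.pi_gt_three
  have bound : ∀ d, sqN (x - y) ≤ d → d ≤ 1 → ∀ H', 0 ≤ H' →
      (∀ w w', sqN (x - y) < sqN (w - w') → sqN (w - w') ≤ d →
        |f w - f w'| ≤ H' * sqN (w - w') ^ β) → H' * d ^ β ≤ 1 → -Real.log d ≤ Real.log H / β →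
      |radialVel f x y| ≤ sqN (x - y) * ((radialConst I + 1 + Real.log H) / β) := by
    intro d hd hd1 H' hH' hf' hHd hld
    refine (abs_radialVel_le hf h1 hI hxy hd hd1 hβ hH' hf').trans ?_
    rw [div_mul_eq_mul_div, mul_div_assoc]
    refine mul_le_mul_of_nonneg_left ?_ hn.le
    have e1 := div_pi_le_radialConst hI0
    have e2 : radialConst I ≤ radialConst I / β := le_div_self hC.le hβ hβ1
    have e3 : H' * d ^ β / β ≤ 1 / β := by gcongr
    have e4 : -Real.log d / π ≤ Real.log H / β := by
      rcases le_total 0 (-Real.log d) with h | h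
      · exact (div_le_self h (by linarith)).trans hld
      · exact (div_nonpos_of_nonpos_of_nonneg h Real.pi_pos.le).trans (by positivity)
    have e5 : (strainConst + π * H' * d ^ β / β - Real.log d + π / 2 + I) / π
        = (strainConst + π / 2 + I) / π + H' * d ^ β / β + -Real.log d / π := by
      field_simp; ring
    have e6 : (radialConst I + 1 + Real.log H) / β
        = radialConst I / β + 1 / β + Real.log H / β := by ring
    rw [e5, e6]
    linarith
  set d₀ := H ^ (-β⁻¹) with hd₀
  have hd₀1 : d₀ ≤ 1 := Real.rpow_le_one_of_one_le_of_nonpos hH (by simp [hβ.le])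
  have hd₀0 : 0 < d₀ := Real.rpow_pos_of_pos hH0 _
  have hld₀ : -Real.log d₀ = Real.log H / β := by
    rw [hd₀, Real.log_rpow hH0]; field_simp
  rcases le_total (sqN (x - y)) d₀ with h | h
  · refine bound d₀ h hd₀1 H (by linarith) (fun w w' _ _ => hfH w w') (le_of_eq ?_) hld₀.le
    rw [hd₀, ← Real.rpow_mul hH0.le, neg_mul, inv_mul_cancel₀ hβ.ne', Real.rpow_neg_one,
      mul_inv_cancel₀ hH0.ne']
  rcases le_total (sqN (x - y)) 1 with h' | h'
  · refine bound _ le_rfl h' 0 le_rfl (fun w w' h h' => absurd h (not_lt.2 h')) (by simp) ?_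
    rw [← hld₀]
    linarith [Real.log_le_log hd₀0 h]
  · refine (abs_radialVel_le_of_one_le hf h1 hI h').trans ?_
    refine mul_le_mul_of_nonneg_left ?_ hn.le
    have : 4 * ((∫ v, nearKernel v) + I) ≤ radialConst I + 1 + Real.log H := by
      unfold radialConst; linarith [strainConst_nonneg]
    exact this.trans (le_div_self (by linarith) hβ hβ1)

/-- Classical solutions of the vorticity equation on `[0,∞) × ℝ²` with vorticity bounded by one and
`L¹` norm bounded by `I`. -/
structure IsEulerSolution (I : ℝ) (ω : ℝ → ℝ × ℝ → ℝ) : Prop where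
  contDiffOn : ContDiffOn ℝ 1 (Function.uncurry ω) (Ici (0 : ℝ) ×ˢ (univ : Set (ℝ × ℝ)))
  integrable : ∀ t, 0 ≤ t → Integrable (ω t)
  lipschitz : ∀ t, 0 ≤ t → ∃ K : ℝ≥0, LipschitzWith K (ω t)
  abs_le_one : ∀ t, 0 ≤ t → ∀ x, |ω t x| ≤ 1
  integral_abs_le : ∀ t, 0 ≤ t → ∫ y, |ω t y| ≤ I
  transport : ∀ t, 0 ≤ t → ∀ x, derivWithin (fun τ => ω τ x) (Ici (0 : ℝ)) t
    + (biotSavart (ω t) x).1 * fderiv ℝ (ω t) x (1, 0)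
    + (biotSavart (ω t) x).2 * fderiv ℝ (ω t) x (0, 1) = 0

namespace IsEulerSolution

variable {I : ℝ} {ω : ℝ → ℝ × ℝ → ℝ} (h : IsEulerSolution I ω)
include h

lemma nonneg : 0 ≤ I :=
  (integral_nonneg fun _ => abs_nonneg _).trans (h.integral_abs_le 0 le_rfl)

lemma hasFDerivWithinAt {t : ℝ} (ht : 0 ≤ t) (x : ℝ × ℝ) :
    HasFDerivWithinAt (Function.uncurry ω)
      (fderivWithin ℝ (Function.uncurry ω) (Ici (0 : ℝ) ×ˢ univ) (t, x))
      (Ici (0 : ℝ) ×ˢ univ) (t, x) :=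
  (h.contDiffOn.differentiableOn one_ne_zero (t, x) ⟨ht, mem_univ _⟩).hasFDerivWithinAt

lemma exists_lipschitz_closedBall (T : ℝ) (x₀ : ℝ × ℝ) (R : ℝ) :
    ∃ L : ℝ, 0 ≤ L ∧ ∀ t ∈ Icc 0 T, ∀ x ∈ Metric.closedBall x₀ R, ∀ y ∈ Metric.closedBall x₀ R,
      |ω t x - ω t y| ≤ L * ‖x - y‖ := by
  have hsub : Icc 0 T ×ˢ Metric.closedBall x₀ R ⊆ Ici (0 : ℝ) ×ˢ univ :=
    prod_mono Icc_subset_Ici_self (subset_univ _)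
  obtain ⟨L, hL⟩ := (isCompact_Icc.prod (isCompact_closedBall x₀ R)).exists_bound_of_continuousOn
    ((h.contDiffOn.continuousOn_fderivWithin ((uniqueDiffOn_Ici 0).prod uniqueDiffOn_univ)
      le_rfl).mono hsub)
  refine ⟨max L 0, le_max_right _ _, fun t ht x hx y hy => ?_⟩
  have hconv := (convex_Icc 0 T).prod (convex_closedBall x₀ R)
  have := hconv.norm_image_sub_le_of_norm_hasFDerivWithin_le
    (f := Function.uncurry ω) (C := max L 0) (x := (t, y)) (y := (t, x))
    (fun p hp => (h.hasFDerivWithinAt hp.1.1 p.2).mono hsub)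
    (fun p hp => (hL p hp).trans (le_max_left _ _)) ⟨ht, hy⟩ ⟨ht, hx⟩
  simpa [Prod.norm_def] using this

lemma continuousOn_biotSavart (x : ℝ × ℝ) :
    ContinuousOn (fun t => biotSavart (ω t) x) (Ici 0) := by
  have hc : ∀ y, ContinuousOn (fun t => ω t y) (Ici 0) := fun y =>
    h.contDiffOn.continuousOn.comp (f := fun t => (t, y)) (by fun_prop)
      fun t ht => ⟨ht, mem_univ _⟩
  simp only [biotSavart_eq]
  exact ((continuousOn_rieszInt snd_sq_le_sqN hc h.integrable h.abs_le_one
    h.integral_abs_le x).const_mul _).prodMk ((continuousOn_rieszInt neg_fst_sq_le_sqN hc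
    h.integrable h.abs_le_one h.integral_abs_le x).const_mul _)

lemma norm_biotSavart_le {t : ℝ} (ht : 0 ≤ t) (x : ℝ × ℝ) :
    ‖biotSavart (ω t) x‖ ≤ (∫ v, nearKernel v) + I :=
  max_le_iff.2 (abs_biotSavart_le (h.integrable t ht) (h.abs_le_one t ht) (h.integral_abs_le t ht) x)

lemma exists_lipschitzOnWith_biotSavart (T : ℝ) (x₀ : ℝ × ℝ) (R : ℝ) :
    ∃ K : ℝ≥0, ∀ t ∈ Icc 0 T,
      LipschitzOnWith K (biotSavart (ω t)) (Metric.closedBall x₀ R) := by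
  obtain ⟨L, hL0, hL⟩ := h.exists_lipschitz_closedBall T x₀ (R + 1)
  have hN := integral_nearKernel_nonneg
  have hI := h.nonneg
  refine ⟨⟨(∫ v, nearKernel v) * L + 2 * I, by positivity⟩, fun t ht =>
    LipschitzOnWith.of_dist_le_mul fun x hx y hy => ?_⟩
  have hball : ∀ z ∈ Metric.closedBall x₀ R, ∀ v : ℝ × ℝ, ‖v‖ < 1 →
      z - v ∈ Metric.closedBall x₀ (R + 1) := fun z hz v hv => by
    rw [mem_closedBall_iff_norm] at hz ⊢
    rw [sub_right_comm]
    exact (norm_sub_le _ _).trans (by linarith)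
  have hloc : ∀ v : ℝ × ℝ, ‖v‖ < 1 → |ω t (x - v) - ω t (y - v)| ≤ L * ‖x - y‖ := fun v hv => by
    simpa using hL t ht _ (hball x hx v hv) _ (hball y hy v hv)
  have hle : ∀ r s : ℝ,
      |r - s| ≤ ((∫ v, nearKernel v) * L + 2 * ∫ y, |ω t y|) * ‖x - y‖ →
      dist (1 / (2 * π) * r) (1 / (2 * π) * s)
        ≤ ((∫ v, nearKernel v) * L + 2 * I) * dist x y := fun r s hrs => by
    rw [Real.dist_eq, ← mul_sub, abs_mul, abs_of_pos (by positivity : 0 < 1 / (2 * π)),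
      dist_eq_norm]
    refine (mul_le_of_le_one_left (abs_nonneg _) ?_).trans (hrs.trans ?_)
    · rw [div_le_one (by positivity)]
      linarith [Real.pi_gt_three]
    · gcongr
      exact h.integral_abs_le t ht.1
  rw [biotSavart_eq, biotSavart_eq, Prod.dist_eq]
  exact max_le
    (hle _ _ (abs_rieszInt_sub_le snd_sq_le_sqN (h.integrable t ht.1) (h.abs_le_one t ht.1) hloc))
    (hle _ _ (abs_rieszInt_sub_le neg_fst_sq_le_sqN (h.integrable t ht.1) (h.abs_le_one t ht.1)
      hloc))

/-- Existence of backward particle trajectories. -/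
lemma exists_trajectory {T : ℝ} (hT : 0 ≤ T) (x : ℝ × ℝ) :
    ∃ X : ℝ → ℝ × ℝ, X T = x ∧
      ∀ t ∈ Icc 0 T, HasDerivWithinAt X (biotSavart (ω t) (X t)) (Icc 0 T) t := by
  have hM : 0 ≤ (∫ v, nearKernel v) + I := add_nonneg integral_nearKernel_nonneg h.nonneg
  lift (∫ v, nearKernel v) + I to ℝ≥0 using hM with M hMeq
  lift T to ℝ≥0 using hT
  obtain ⟨K, hK⟩ := h.exists_lipschitzOnWith_biotSavart T x (M * T : ℝ≥0)
  have hPL : IsPicardLindelof (fun t => biotSavart (ω t))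
      (⟨T, T.2, le_rfl⟩ : Icc (0 : ℝ) T) x (M * T) 0 M K :=
    { lipschitzOnWith := hK
      continuousOn := fun y _ => (h.continuousOn_biotSavart y).mono Icc_subset_Ici_self
      norm_le := fun t ht y _ => hMeq ▸ h.norm_biotSavart_le ht.1 y
      mul_max_le := by simp }
  exact hPL.exists_eq_forall_mem_Icc_hasDerivWithinAt₀

/-- The vorticity is constant along trajectories. -/
lemma transport_eq {T : ℝ} {X : ℝ → ℝ × ℝ}
    (hX : ∀ t ∈ Icc 0 T, HasDerivWithinAt X (biotSavart (ω t) (X t)) (Icc 0 T) t) {t : ℝ}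
    (ht : t ∈ Icc 0 T) : ω t (X t) = ω 0 (X 0) := by
  have hd : ∀ t ∈ Icc 0 T, HasDerivWithinAt (fun s => ω s (X s)) 0 (Icc 0 T) t := by
    intro t ht
    have hF := h.hasFDerivWithinAt ht.1 (X t)
    set F' := fderivWithin ℝ (Function.uncurry ω) (Ici (0 : ℝ) ×ˢ univ) (t, X t)
    have d1 : derivWithin (fun τ => ω τ (X t)) (Ici (0 : ℝ)) t = F' (1, 0) :=
      (hF.comp_hasDerivWithinAt (f := fun τ : ℝ => (τ, X t)) t
        ((hasDerivWithinAt_id t _).prodMk (hasDerivWithinAt_const t _ (X t)))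
        (fun τ hτ => ⟨hτ, mem_univ _⟩)).derivWithin (uniqueDiffOn_Ici 0 t ht.1)
    have d2 : fderiv ℝ (ω t) (X t) = F'.comp (ContinuousLinearMap.inr ℝ ℝ (ℝ × ℝ)) := by
      have := hF.comp (f := fun y : ℝ × ℝ => (t, y)) (s := univ) (X t)
        (hasFDerivAt_prodMk_right t (X t)).hasFDerivWithinAt (fun y _ => ⟨ht.1, mem_univ _⟩)
      exact (hasFDerivWithinAt_univ.1 this).fderiv
    have d3 := hF.comp_hasDerivWithinAt (f := fun τ : ℝ => (τ, X τ)) t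
      ((hasDerivWithinAt_id t _).prodMk (hX t ht)) (fun τ hτ => ⟨hτ.1, mem_univ _⟩)
    have e : F' (1, biotSavart (ω t) (X t)) = 0 := by
      have heq := h.transport t ht.1 (X t)
      rw [d1, d2] at heq
      rw [← heq]
      simp only [ContinuousLinearMap.comp_apply, ContinuousLinearMap.inr_apply]
      rw [← smul_eq_mul, ← smul_eq_mul, ← map_smul, ← map_smul, ← map_add, ← map_add]
      congr 1
      ext <;> simp
    exact d3.congr_deriv e
  exact (constant_of_has_deriv_right_zero (fun t ht => (hd t ht).continuousWithinAt)
    (fun t ht => (hd t (Ico_subset_Icc_self ht)).mono_of_mem_nhdsWithin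
      (Icc_mem_nhdsGE_of_mem ht)) t ht)

end IsEulerSolution

lemma le_exp_mul_of_deriv_le {g g' : ℝ → ℝ} {c T : ℝ} (hT : 0 ≤ T)
    (hg : ∀ t ∈ Icc 0 T, HasDerivWithinAt g (g' t) (Icc 0 T) t)
    (hle : ∀ t ∈ Icc 0 T, g' t ≤ c * g t) : g T ≤ Real.exp (c * T) * g 0 := by
  have hd : ∀ t ∈ Icc 0 T, HasDerivWithinAt (fun s => Real.exp (-c * s) * g s)
      (Real.exp (-c * t) * (-c * 1) * g t + Real.exp (-c * t) * g' t) (Icc 0 T) t := fun t ht =>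
    (((hasDerivWithinAt_id t _).const_mul (-c)).exp).mul (hg t ht)
  have hanti := antitoneOn_of_hasDerivWithinAt_nonpos (convex_Icc 0 T)
    (fun t ht => (hd t ht).continuousWithinAt)
    (fun t ht => (hd t (interior_subset ht)).mono interior_subset)
    (fun t ht => by
      have := mul_le_mul_of_nonneg_left (hle t (interior_subset ht)) (Real.exp_pos (-c * t)).le
      linarith)
  have := hanti (left_mem_Icc.2 hT) (right_mem_Icc.2 hT) hT
  simp only [mul_zero, Real.exp_zero, one_mul, neg_mul, Real.exp_neg] at this
  rwa [inv_mul_le_iff₀ (Real.exp_pos _)] at this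

lemma min_one_le_of_log_one_add_ge {n r c : ℝ} (hn : 0 < n)
    (h : -c ≤ Real.log (1 + 1 / n) + r) : min n 1 ≤ 2 * Real.exp r * Real.exp c := by
  have h1 : Real.exp (-(c + r)) ≤ 1 + 1 / n := by
    rw [← Real.le_log_iff_exp_le (by positivity)]; linarith
  rw [mul_assoc, ← Real.exp_add, add_comm r c]
  have hm : min n 1 * (1 + 1 / n) ≤ 2 := by
    rw [mul_add, mul_one]
    have : min n 1 * (1 / n) ≤ 1 := by
      rw [mul_one_div, div_le_one hn]; exact min_le_left _ _
    linarith [min_le_right n 1]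
  have h2 := (mul_le_mul_of_nonneg_left h1 (le_min hn.le zero_le_one)).trans hm
  rwa [Real.exp_neg, ← div_eq_mul_inv, div_le_iff₀ (Real.exp_pos _)] at h2

namespace IsEulerSolution

variable {I : ℝ} {ω : ℝ → ℝ × ℝ → ℝ} (h : IsEulerSolution I ω)
include h

section Pair

variable {T : ℝ} (hT : 0 ≤ T) {X Y : ℝ → ℝ × ℝ}
  (hX : ∀ t ∈ Icc 0 T, HasDerivWithinAt X (biotSavart (ω t) (X t)) (Icc 0 T) t)
  (hY : ∀ t ∈ Icc 0 T, HasDerivWithinAt Y (biotSavart (ω t) (Y t)) (Icc 0 T) t)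
include hX hY

omit h in
lemma hasDerivWithinAt_sqN_sub {t : ℝ} (ht : t ∈ Icc 0 T) :
    HasDerivWithinAt (fun s => sqN (X s - Y s)) (2 * radialVel (ω t) (X t) (Y t)) (Icc 0 T) t := by
  have hd := (hX t ht).sub (hY t ht)
  have h1 := (hasFDerivAt_fst (𝕜 := ℝ) (p := X t - Y t)).comp_hasDerivWithinAt t hd
  have h2 := (hasFDerivAt_snd (𝕜 := ℝ) (p := X t - Y t)).comp_hasDerivWithinAt t hd
  refine ((h1.pow 2).add (h2.pow 2)).congr_deriv ?_
  simp [radialVel]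
  ring

include h hT

lemma eq_of_trajectories_meet {t : ℝ} (ht : t ∈ Icc 0 T) (hXY : X t = Y t) :
    ω T (X T) = ω T (Y T) := by
  have hTm := right_mem_Icc.2 hT
  rw [h.transport_eq hX hTm, h.transport_eq hY hTm, ← h.transport_eq hX ht,
    ← h.transport_eq hY ht, hXY]

lemma min_sqN_initial_le (hne : ∀ t ∈ Icc 0 T, X t ≠ Y t) :
    min (sqN (X 0 - Y 0)) 1 ≤ 2 * Real.exp (π * radialConst I) *
      sqN (X T - Y T) ^ Real.exp (-(2 / π * T)) := by
  have hpi := Real.pi_pos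
  have hC := radialConst_pos h.nonneg
  set n : ℝ → ℝ := fun t => sqN (X t - Y t) with hn
  have hn0 : ∀ t ∈ Icc 0 T, 0 < n t := fun t ht => sqN_pos (sub_ne_zero.2 (hne t ht))
  have hd : ∀ t ∈ Icc 0 T, HasDerivWithinAt
      (fun s => Real.log (1 + 1 / n s) + π * radialConst I)
      (-(2 * radialVel (ω t) (X t) (Y t)) / (n t * (n t + 1))) (Icc 0 T) t := by
    intro t ht
    have hnt := hn0 t ht
    have h1 := ((((hasDerivWithinAt_sqN_sub hX hY ht).inv hnt.ne').const_add 1).log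
      (add_pos one_pos (inv_pos.2 hnt)).ne').add_const (π * radialConst I)
    simp only [one_div]
    refine h1.congr_deriv ?_
    change -(2 * radialVel (ω t) (X t) (Y t)) / n t ^ 2 / (1 + (n t)⁻¹) = _
    field_simp
  have key := le_exp_mul_of_deriv_le (c := 2 / π) hT hd fun t ht => by
    have hnt := hn0 t ht
    have hb := abs_radialVel_le_log (h.integrable t ht.1) (h.abs_le_one t ht.1)
      (h.integral_abs_le t ht.1) (hne t ht)
    change |_| ≤ n t * (radialConst I + 1 / π * Real.log (1 + 1 / n t)) at hb
    have hlog : 0 ≤ Real.log (1 + 1 / n t) :=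
      Real.log_nonneg (le_add_of_nonneg_right (by positivity))
    rw [div_le_iff₀ (mul_pos hnt (by linarith))]
    have e : 2 / π * (Real.log (1 + 1 / n t) + π * radialConst I)
        = 2 * (radialConst I + 1 / π * Real.log (1 + 1 / n t)) := by field_simp; ring
    rw [e]
    set D := radialConst I + 1 / π * Real.log (1 + 1 / n t)
    have hD : 0 ≤ D := by positivity
    have := (neg_le_abs _).trans hb
    nlinarith [mul_nonneg hD (mul_nonneg hnt.le hnt.le)]
  have hnT := hn0 T (right_mem_Icc.2 hT)
  have hlogT : -Real.log (n T) ≤ Real.log (1 + 1 / n T) := by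
    rw [← Real.log_inv]
    exact Real.log_le_log (by positivity) (by rw [one_div]; linarith)
  rw [Real.rpow_def_of_pos hnT]
  refine min_one_le_of_log_one_add_ge (hn0 0 (left_mem_Icc.2 hT)) ?_
  rw [Real.exp_neg, ← div_eq_mul_inv, ← neg_div, div_le_iff₀ (Real.exp_pos _)]
  have : 0 ≤ π * radialConst I := by positivity
  linarith

omit h in
lemma sqN_initial_le {B : ℝ}
    (hB : ∀ t ∈ Icc 0 T, |radialVel (ω t) (X t) (Y t)| ≤ sqN (X t - Y t) * B) :
    sqN (X 0 - Y 0) ≤ Real.exp (2 * B * T) * sqN (X T - Y T) := by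
  have key := le_exp_mul_of_deriv_le (c := -(2 * B)) hT
    (fun t ht => (hasDerivWithinAt_sqN_sub hX hY ht).neg) fun t ht => by
      have := (neg_le_abs _).trans (hB t ht)
      simp only [Pi.neg_apply]
      linarith
  simp only [Pi.neg_apply, neg_mul, Real.exp_neg, mul_neg, neg_le_neg_iff] at key
  rwa [inv_mul_le_iff₀ (Real.exp_pos _)] at key

end Pair

/-- Hölder bound with exponentially decaying exponent and constant uniform in time. -/
lemma exists_holder_bound : ∃ H : ℝ, 1 ≤ H ∧ ∀ T, 0 ≤ T → ∀ x y,
    |ω T x - ω T y| ≤ H * sqN (x - y) ^ (Real.exp (-(2 / π * T)) / 2) := by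
  obtain ⟨K, hK⟩ := h.lipschitz 0 le_rfl
  set L : ℝ := max K 2
  have hL : 2 ≤ L := le_max_right _ _
  have hC := radialConst_pos h.nonneg
  have hinit : ∀ a b, |ω 0 a - ω 0 b| ≤ L * √(min (sqN (a - b)) 1) := fun a b => by
    rcases le_total (sqN (a - b)) 1 with hle | hle
    · rw [min_eq_left hle]
      have := hK.dist_le_mul a b
      rw [Real.dist_eq, dist_eq_norm] at this
      refine this.trans (mul_le_mul (le_max_left _ _) (norm_le_sqrt_sqN _) (norm_nonneg _)
        (by linarith))
    · rw [min_eq_right hle, Real.sqrt_one, mul_one]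
      exact (abs_sub _ _).trans (by linarith [h.abs_le_one 0 le_rfl a, h.abs_le_one 0 le_rfl b])
  refine ⟨L * √(2 * Real.exp (π * radialConst I)), ?_, fun T hT x y => ?_⟩
  · have : 1 ≤ √(2 * Real.exp (π * radialConst I)) := by
      rw [Real.one_le_sqrt]
      have := Real.one_le_exp (by positivity : 0 ≤ π * radialConst I)
      linarith
    nlinarith
  obtain ⟨X, rfl, hX⟩ := h.exists_trajectory hT x
  obtain ⟨Y, rfl, hY⟩ := h.exists_trajectory hT y
  by_cases hne : ∀ t ∈ Icc 0 T, X t ≠ Y t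
  · have hTm := right_mem_Icc.2 hT
    rw [h.transport_eq hX hTm, h.transport_eq hY hTm]
    refine (hinit _ _).trans ?_
    rw [mul_assoc]
    gcongr
    refine (Real.sqrt_le_sqrt (h.min_sqN_initial_le hT hX hY hne)).trans_eq ?_
    rw [Real.sqrt_mul (by positivity), Real.sqrt_eq_rpow (_ ^ _), ← Real.rpow_mul (sqN_nonneg _),
      mul_one_div]
  · push Not at hne
    obtain ⟨t, ht, hXY⟩ := hne
    rw [h.eq_of_trajectories_meet hT hX hY ht hXY, sub_self, abs_zero]
    have := sqN_nonneg (X T - Y T)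
    positivity

/-- Double exponential bound for the vorticity gradient. -/
lemma exists_gradSup_le : ∃ K D : ℝ, 0 ≤ K ∧ 0 ≤ D ∧ ∀ T, 0 ≤ T →
    gradSup (ω T) ≤ K * Real.exp (D * T * Real.exp (2 / π * T)) := by
  obtain ⟨H, hH, hHol⟩ := h.exists_holder_bound
  obtain ⟨K, hK⟩ := h.lipschitz 0 le_rfl
  have hpi := Real.pi_pos
  have hC := radialConst_pos h.nonneg
  have hlogH := Real.log_nonneg hH
  set A := radialConst I + 1 + Real.log H
  have hA : 0 ≤ A := by positivity
  refine ⟨2 * K, 2 * A, by positivity, by positivity, fun T hT => ?_⟩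
  set E := Real.exp (2 * A * T * Real.exp (2 / π * T))
  have hE : 0 < E := Real.exp_pos _
  have hlip : LipschitzWith ⟨2 * K * E, by positivity⟩ (ω T) := by
    refine LipschitzWith.of_dist_le_mul fun x y => ?_
    change |ω T x - ω T y| ≤ 2 * K * E * dist x y
    obtain ⟨X, rfl, hX⟩ := h.exists_trajectory hT x
    obtain ⟨Y, rfl, hY⟩ := h.exists_trajectory hT y
    by_cases hne : ∀ t ∈ Icc 0 T, X t ≠ Y t
    · have hTm := right_mem_Icc.2 hT
      rw [h.transport_eq hX hTm, h.transport_eq hY hTm]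
      have h0 := hK.dist_le_mul (X 0) (Y 0)
      rw [Real.dist_eq, dist_eq_norm] at h0
      have hn0 := sqN_initial_le hT hX hY (B := 2 * A * Real.exp (2 / π * T)) fun t ht => by
        refine (abs_radialVel_le_of_holder (h.integrable t ht.1) (h.abs_le_one t ht.1)
          (h.integral_abs_le t ht.1) (hne t ht) (by positivity) ?_ hH (hHol t ht.1)).trans ?_
        · have : Real.exp (-(2 / π * t)) ≤ 1 :=
            Real.exp_le_one_iff.2 (neg_nonpos.2 (mul_nonneg (by positivity) ht.1))
          linarith
        · refine mul_le_mul_of_nonneg_left ?_ (sqN_nonneg _)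
          rw [Real.exp_neg, div_div_eq_mul_div, div_inv_eq_mul, mul_comm A 2]
          have := ht.2
          gcongr
      have hs : √(sqN (X 0 - Y 0)) ≤ E * (2 * ‖X T - Y T‖) := by
        refine (Real.sqrt_le_sqrt hn0).trans ?_
        rw [Real.sqrt_mul (Real.exp_pos _).le]
        refine mul_le_mul (le_of_eq ?_) (sqrt_sqN_le _) (Real.sqrt_nonneg _) hE.le
        rw [Real.sqrt_eq_rpow, ← Real.exp_mul]
        congr 1
        ring
      calc |ω 0 (X 0) - ω 0 (Y 0)| ≤ K * ‖X 0 - Y 0‖ := h0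
        _ ≤ K * (E * (2 * ‖X T - Y T‖)) := by
            gcongr
            exact (norm_le_sqrt_sqN _).trans hs
        _ = 2 * K * E * dist (X T) (Y T) := by rw [dist_eq_norm]; ring
    · push Not at hne
      obtain ⟨t, ht, hXY⟩ := hne
      rw [h.eq_of_trajectories_meet hT hX hY ht hXY, sub_self, abs_zero]
      positivity
  exact ciSup_le fun x => norm_fderiv_le_of_lipschitz ℝ hlip

end IsEulerSolution

/-- A double exponential bound controls the limit superior of the iterated logarithm. -/
lemma limsup_log_log_div_le {g : ℝ → ℝ} {K D κ : ℝ} (hK : 0 ≤ K) (hD : 0 ≤ D) (hκ : 0 ≤ κ)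
    (hg : ∀ t, 0 ≤ t → g t ≤ K * Real.exp (D * t * Real.exp (κ * t))) :
    limsup (fun t : ℝ => Real.log (Real.log (max (g t) (Real.exp 1))) / t) atTop ≤ κ := by
  have hlogK : 0 ≤ Real.log (K + 1) := Real.log_nonneg (by linarith)
  set A := Real.log (K + 1) + D + 1
  have hA : 1 ≤ A := by simp only [A]; linarith
  have hlog1 : ∀ t, 1 ≤ Real.log (max (g t) (Real.exp 1)) := fun t => by
    rw [Real.le_log_iff_exp_le (lt_max_of_lt_right (Real.exp_pos 1))]
    exact le_max_right _ _
  have hle : ∀ t, 0 < t → Real.log (Real.log (max (g t) (Real.exp 1))) / t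
      ≤ Real.log A / t + Real.log (1 + t) / t + κ := by
    intro t ht
    have hexp : 1 ≤ Real.exp (κ * t) := Real.one_le_exp (by positivity)
    have h1 : Real.log (max (g t) (Real.exp 1)) ≤ A * (1 + t) * Real.exp (κ * t) := by
      rw [Real.log_le_iff_le_exp (lt_max_of_lt_right (Real.exp_pos 1))]
      have e1 : Real.log (K + 1) + D * t * Real.exp (κ * t) ≤ A * (1 + t) * Real.exp (κ * t) := by
        have : Real.log (K + 1) ≤ Real.log (K + 1) * Real.exp (κ * t) :=
          le_mul_of_one_le_right hlogK hexp
        have e2 : A * (1 + t) * Real.exp (κ * t) = Real.log (K + 1) * Real.exp (κ * t)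
            + D * t * Real.exp (κ * t)
            + ((Real.log (K + 1) * t + D + 1 + t) * Real.exp (κ * t)) := by
          simp only [A]; ring
        have : 0 ≤ (Real.log (K + 1) * t + D + 1 + t) * Real.exp (κ * t) := by positivity
        linarith
      refine max_le ((hg t ht.le).trans ?_) (Real.exp_le_exp.2 ?_)
      · calc K * Real.exp (D * t * Real.exp (κ * t))
            ≤ (K + 1) * Real.exp (D * t * Real.exp (κ * t)) := by gcongr; linarith
          _ = Real.exp (Real.log (K + 1) + D * t * Real.exp (κ * t)) := by
            rw [Real.exp_add, Real.exp_log (by linarith)]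
          _ ≤ _ := Real.exp_le_exp.2 e1
      · have : 1 ≤ A * (1 + t) := by nlinarith
        nlinarith
    have h2 := Real.log_le_log (by linarith [hlog1 t]) h1
    rw [Real.log_mul (by positivity) (by positivity), Real.log_mul (by positivity) (by positivity),
      Real.log_exp] at h2
    calc _ ≤ (Real.log A + Real.log (1 + t) + κ * t) / t := by gcongr
      _ = _ := by field_simp
  have hlim : Tendsto (fun t : ℝ => Real.log A / t + Real.log (1 + t) / t + κ) atTop (nhds κ) := by
    have l1 : Tendsto (fun t : ℝ => Real.log A / t) atTop (nhds 0) :=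
      tendsto_const_nhds.div_atTop tendsto_id
    have l2 : Tendsto (fun t : ℝ => Real.log (1 + t) / t) atTop (nhds 0) := by
      have h0 := Real.isLittleO_log_id_atTop.tendsto_div_nhds_zero.comp
        (tendsto_atTop_add_const_left atTop (1 : ℝ) tendsto_id)
      have h1 : Tendsto (fun t : ℝ => 1 / t + 1) atTop (nhds (0 + 1)) :=
        (tendsto_const_nhds.div_atTop tendsto_id).add_const 1
      have h2 := h0.mul h1
      rw [zero_mul] at h2
      refine h2.congr' ?_
      filter_upwards [eventually_gt_atTop 0] with t ht
      simp only [Function.comp_apply, id_eq]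
      have : 1 + t ≠ 0 := by positivity
      field_simp
    simpa using (l1.add l2).add_const κ
  rw [← hlim.limsup_eq]
  refine limsup_le_limsup ?_ ?_ hlim.isBoundedUnder_le
  · filter_upwards [eventually_gt_atTop 0] with t ht using hle t ht
  · refine IsCoboundedUnder.of_frequently_ge (a := 0) (Eventually.frequently ?_)
    filter_upwards [eventually_gt_atTop 0] with t ht
    exact div_nonneg (Real.log_nonneg (hlog1 t)) ht.le

theorem statement1 (I : ℝ) (hI : 1 ≤ I) (ω : ℝ → ℝ × ℝ → ℝ)
    -- ω is continuously differentiable on [0,∞) × ℝ²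
    (hC1 : ContDiffOn ℝ 1 (Function.uncurry ω) (Ici (0 : ℝ) ×ˢ (univ : Set (ℝ × ℝ))))
    -- for every t ≥ 0, ω(t,·) ∈ L¹ ∩ W^{1,∞} with ‖ω(t,·)‖_{L^∞} ≤ 1 and ‖ω(t,·)‖_{L¹} ≤ I
    (hreg : ∀ t : ℝ, 0 ≤ t →
      Integrable (ω t) (volume : Measure (ℝ × ℝ)) ∧
      (∃ K : ℝ≥0, LipschitzWith K (ω t)) ∧
      (∀ x : ℝ × ℝ, |ω t x| ≤ 1) ∧
      (∫ y : ℝ × ℝ, |ω t y|) ≤ I)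
    -- the transport (Euler vorticity) equation ∂_t ω + u·∇ω = 0
    (heq : ∀ t : ℝ, 0 ≤ t → ∀ x : ℝ × ℝ,
      derivWithin (fun τ => ω τ x) (Ici (0 : ℝ)) t
        + (biotSavart (ω t) x).1 * fderiv ℝ (ω t) x (1, 0)
        + (biotSavart (ω t) x).2 * fderiv ℝ (ω t) x (0, 1) = 0) :
    -- conclusion: limsup_{t→∞} (ln ln max{‖∇ω(t,·)‖_{L^∞}, e}) / t ≤ 2/π
    Filter.limsup
        (fun t : ℝ => Real.log (Real.log (max (gradSup (ω t)) (Real.exp 1))) / t)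
        atTop
      ≤ 2 / π := by
  obtain ⟨K, D, hK, hD, hbound⟩ := IsEulerSolution.exists_gradSup_le (I := I) (ω := ω)
    { contDiffOn := hC1
      integrable := fun t ht => (hreg t ht).1
      lipschitz := fun t ht => (hreg t ht).2.1
      abs_le_one := fun t ht => (hreg t ht).2.2.1
      integral_abs_le := fun t ht => (hreg t ht).2.2.2
      transport := heq }
  exact limsup_log_log_div_le hK hD (by positivity) hbound
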